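/- arXiv:1201.4066 — 3 statements merged into one kernel-verified Lean document; each statement's English description precedes it below -/
import Mathlib

section
/- Let a_1,...,a_m ∈ ℝ[X] and let S := {a_1 ≥ 0,...,a_m ≥ 0}. Let f ∈ ℝ[X] be strictly positive on S. Suppose l_1,...,l_d ∈ ℝ[X] are degree ≤ 1 polynomials with ℝ[X] = ℝ[l_1,...,l_d], and let q := t − Σ_{i=1}^d l_i − Σ_{j=1}^m a_j for some t > 0. Then f belongs to the semiring cone generated by l_1,...,l_d, a_1,...,a_m, q. -/
open Finset MvPolynomial

/-- The semiring cone generated by a finite family `g : ι → ℝ[X]`. -/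
def SCone {d : ℕ} {ι : Type*} [Fintype ι] (g : ι → MvPolynomial (Fin d) ℝ) :
    Set (MvPolynomial (Fin d) ℝ) :=
  {f | ∃ (N : ℕ) (c : Fin N → ℝ) (k : Fin N → ι → ℕ),
        (∀ j, 0 ≤ c j) ∧ f = ∑ j, C (c j) * ∏ i, g i ^ k j i}

theorem mem_SCone_of_adjoin {d : ℕ} {ι : Type*} [Fintype ι] (g : ι → MvPolynomial (Fin d) ℝ)
    (p : MvPolynomial (Fin d) ℝ) (hp : p ∈ Algebra.adjoin NNReal (Set.range g)) :
    p ∈ SCone g := by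
  rw [Algebra.adjoin_range_eq_range_aeval] at hp
  obtain ⟨q, rfl⟩ := hp
  refine ⟨q.support.card, fun j => ((q.coeff (q.support.equivFin.symm j).1 : NNReal) : ℝ),
    fun j i => (q.support.equivFin.symm j).1 i, fun j => NNReal.coe_nonneg _, ?_⟩
  change aeval g q = _
  rw [aeval_def, eval₂_eq']
  rw [← Finset.sum_coe_sort q.support]
  rw [← Equiv.sum_comp q.support.equivFin.symm]
  rfl

theorem rep_thm {A : Type*} [CommRing A] [Algebra ℝ A] (P : Subalgebra NNReal A)
    (harch : ∀ y : A, ∃ N : ℝ, 0 ≤ N ∧ algebraMap ℝ A N + y ∈ P ∧ algebraMap ℝ A N - y ∈ P)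
    (f : A)
    (hf : ∀ φ : A →ₐ[ℝ] ℝ, (∀ p ∈ P, 0 ≤ φ p) → 0 < φ f) : f ∈ P := by
  by_contra hfP
  have hsm : ∀ r : ℝ, 0 ≤ r → ∀ p ∈ P, r • p ∈ P := fun r hr p hp =>
    P.smul_mem hp (⟨r, hr⟩ : NNReal)
  have halg : ∀ r : ℝ, 0 ≤ r → algebraMap ℝ A r ∈ P := fun r hr => by
    rw [Algebra.algebraMap_eq_smul_one]; exact hsm r hr 1 P.one_mem
  have hneg : ¬ (-1 : A) ∈ P := by
    intro h
    obtain ⟨N, hN, h1, -⟩ := harch f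
    have := P.add_mem h1 (hsm N hN _ h)
    rw [Algebra.algebraMap_eq_smul_one] at this
    apply hfP
    simpa using this
  -- the set of states
  let K : Set (A → ℝ) := {φ | (∀ x y, φ (x + y) = φ x + φ y) ∧ (∀ (r : ℝ) x, φ (r • x) = r * φ x)
    ∧ φ 1 = 1 ∧ ∀ p ∈ P, 0 ≤ φ p}
  have hKne : ∃ φ ∈ K, φ f ≤ 0 := by
    let s : PointedCone ℝ A :=
      { zero_mem' := ⟨0, P.zero_mem, 0, le_rfl, by simp⟩
        carrier := {x | ∃ p ∈ P, ∃ r : ℝ, 0 ≤ r ∧ x = p - r • f}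
        smul_mem' := by
          rintro ⟨c, hc⟩ x ⟨p, hp, r, hr, rfl⟩
          refine ⟨c • p, hsm c hc p hp, c * r, by positivity, ?_⟩
          change c • (p - r • f) = _
          rw [smul_sub, mul_smul]
        add_mem' := by
          rintro _ _ ⟨p, hp, r, hr, rfl⟩ ⟨p', hp', r', hr', rfl⟩
          exact ⟨p + p', P.add_mem hp hp', r + r', by positivity, by rw [add_smul]; abel⟩ }
    have hPs : ∀ p ∈ P, p ∈ s := fun p hp => ⟨p, hp, 0, le_rfl, by simp⟩
    have h1s : ¬ (-1 : A) ∈ s := by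
      rintro ⟨p, hp, r, hr, h⟩
      rcases hr.eq_or_lt with rfl | hr
      · apply hneg; rw [h]; simpa using hp
      · apply hfP
        have : f = r⁻¹ • (p + 1) := by
          have : r • f = p + 1 := by linear_combination h
          rw [← this, smul_smul, inv_mul_cancel₀ hr.ne', one_smul]
        rw [this]
        exact hsm _ (by positivity) _ (P.add_mem hp P.one_mem)
    have h10 : (1 : A) ≠ 0 := by
      intro h
      apply hneg; rw [h]; simp
    obtain ⟨g, hg1, hg2⟩ := riesz_extension s (LinearPMap.mkSpanSingleton (1 : A) (1 : ℝ) h10 : A →ₗ.[ℝ] ℝ)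
      (by
        rintro ⟨x, hx⟩ hxs
        obtain ⟨c, rfl⟩ := Submodule.mem_span_singleton.1 hx
        have : (LinearPMap.mkSpanSingleton (1 : A) (1 : ℝ) h10 : A →ₗ.[ℝ] ℝ) ⟨c • 1, hx⟩ = c := by
          have := LinearPMap.mkSpanSingleton'_apply (1 : A) (1 : ℝ) (σ := RingHom.id ℝ)
            (fun c hc => by
              have := (smul_eq_zero.1 hc).resolve_right h10
              simp [this]) c hx
          simpa using this
        rw [this]
        by_contra hc
        push Not at hc
        apply h1s
        have := s.smul_mem (r := (-c)⁻¹) (by simpa using hc.le) hxs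
        have e : (-1 : A) = (-c)⁻¹ • c • (1 : A) := by
          rw [smul_smul, inv_neg, neg_mul, inv_mul_cancel₀ hc.ne, neg_smul, one_smul]
        rw [e]
        exact this)
      (by
        intro y
        obtain ⟨N, hN, h1, -⟩ := harch y
        refine ⟨⟨algebraMap ℝ A N, ?_⟩, hPs _ h1⟩
        rw [Algebra.algebraMap_eq_smul_one]
        exact Submodule.mem_span_singleton.2 ⟨N, rfl⟩)
    refine ⟨g, ⟨fun x y => map_add g x y, fun r x => by simp, ?_, fun p hp => hg2 p (hPs p hp)⟩, ?_⟩
    · have hx : (1 : A) ∈ (LinearPMap.mkSpanSingleton (1 : A) (1 : ℝ) h10 : A →ₗ.[ℝ] ℝ).domain :=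
        Submodule.mem_span_singleton_self (R := ℝ) (1 : A)
      have := hg1 ⟨1, hx⟩
      rw [this]
      exact LinearPMap.mkSpanSingleton_apply ℝ _ h10 (1 : ℝ)
    · have := hg2 (-f) ⟨0, P.zero_mem, 1, zero_le_one, by simp⟩
      simpa using this
  have hKclosed : IsClosed K := by
    have e : K = (⋂ x, ⋂ y, {φ : A → ℝ | φ (x + y) = φ x + φ y}) ∩
        ((⋂ r : ℝ, ⋂ x, {φ : A → ℝ | φ (r • x) = r * φ x}) ∩
        ({φ : A → ℝ | φ 1 = 1} ∩ ⋂ p ∈ P, {φ : A → ℝ | 0 ≤ φ p})) := by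
      ext φ; simp [K]
    rw [e]
    refine IsClosed.inter ?_ (IsClosed.inter ?_ (IsClosed.inter ?_ ?_))
    · exact isClosed_iInter fun x => isClosed_iInter fun y =>
        isClosed_eq (by fun_prop) (by fun_prop)
    · exact isClosed_iInter fun x => isClosed_iInter fun y =>
        isClosed_eq (by fun_prop) (by fun_prop)
    · exact isClosed_eq (by fun_prop) (by fun_prop)
    · exact isClosed_biInter fun p _ => isClosed_le (by fun_prop) (by fun_prop)
  have hKcompact : IsCompact K := by
    choose N hN hN1 hN2 using harch
    refine IsCompact.of_isClosed_subset
      (isCompact_univ_pi (fun a : A => isCompact_Icc (a := -N a) (b := N a))) hKclosed ?_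
    rintro φ ⟨ha, hs, h1, hp⟩ a -
    have e1 := hp _ (hN1 a)
    have e2 := hp _ (hN2 a)
    rw [Algebra.algebraMap_eq_smul_one] at e1 e2
    rw [ha, hs, h1] at e1
    rw [sub_eq_add_neg, ← neg_one_smul ℝ a, ha, hs, hs, h1] at e2
    constructor <;> linarith
  obtain ⟨φ₀, hφ₀, hφ₀f⟩ := hKne
  obtain ⟨ψ, hψK, hψmin⟩ := hKcompact.exists_isMinOn ⟨φ₀, hφ₀⟩
    (f := fun φ : A → ℝ => φ f) (by fun_prop)
  have hψmin' : ∀ φ ∈ K, ψ f ≤ φ f := fun φ h => hψmin h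
  let F : Set (A → ℝ) := K ∩ {φ | φ f = ψ f}
  have hFcompact : IsCompact F := hKcompact.inter_right
    (isClosed_eq (by fun_prop) (by fun_prop))
  obtain ⟨φ, hφ⟩ := hFcompact.extremePoints_nonempty ⟨ψ, hψK, rfl⟩
  obtain ⟨⟨⟨ha, hs, h1, hp⟩, hφf⟩, hext⟩ := hφ
  replace hφf : φ f = ψ f := hφf
  have hsub : ∀ x y, φ (x - y) = φ x - φ y := fun x y => by
    rw [sub_eq_add_neg, ← neg_one_smul ℝ y, ha, hs]; ring
  -- key
  have hextK : ∀ φ₁ ∈ K, ∀ φ₂ ∈ K, ∀ u v : ℝ, 0 < u → 0 < v → u + v = 1 →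
      (∀ x, φ x = u * φ₁ x + v * φ₂ x) → φ₁ = φ := by
    intro φ₁ h₁ φ₂ h₂ u v hu hv huv h
    have m1 := hψmin' _ h₁
    have m2 := hψmin' _ h₂
    have hff := h f
    rw [hφf] at hff
    have hv' : v = 1 - u := by linarith
    have e1 : φ₁ f = ψ f := by
      apply le_antisymm _ m1
      by_contra hc
      push Not at hc
      have k1 := mul_lt_mul_of_pos_left hc hu
      have k2 := mul_le_mul_of_nonneg_left m2 hv.le
      have k3 : u * ψ f + v * ψ f = ψ f := by rw [← add_mul, huv, one_mul]
      linarith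
    have e2 : φ₂ f = ψ f := by
      apply le_antisymm _ m2
      by_contra hc
      push Not at hc
      have k1 := mul_lt_mul_of_pos_left hc hv
      have k2 := mul_le_mul_of_nonneg_left m1 hu.le
      have k3 : u * ψ f + v * ψ f = ψ f := by rw [← add_mul, huv, one_mul]
      linarith
    have := hext ⟨h₁, e1⟩ ⟨h₂, e2⟩ ⟨u, v, hu, hv, huv, by ext x; simp [h x]⟩
    exact this
  have hmul1 : ∀ p ∈ P, 1 - p ∈ P → 0 < φ p → φ p < 1 → ∀ x, φ (p * x) = φ p * φ x := by
    intro p hpP hpP' h0 hlt x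
    have hK : ∀ q ∈ P, 0 < φ q → (fun x => (φ q)⁻¹ * φ (q * x)) ∈ K := by
      intro q hq hq0
      refine ⟨fun x y => ?_, fun r x => ?_, ?_, fun y hy => ?_⟩
      · simp only [mul_add, ha]
      · simp only [mul_smul_comm, hs]; ring
      · simp only [mul_one]; exact inv_mul_cancel₀ hq0.ne'
      · exact mul_nonneg (by positivity) (hp _ (P.mul_mem hq hy))
    have h0' : 0 < φ (1 - p) := by rw [hsub, h1]; linarith
    have := hextK _ (hK p hpP h0) _ (hK _ hpP' h0') (φ p) (φ (1 - p)) h0 h0'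
      (by rw [hsub, h1]; ring) (by
        intro y
        rw [mul_inv_cancel_left₀ h0.ne', mul_inv_cancel_left₀ h0'.ne', ← ha]
        congr 1; ring)
    have := congrFun this x
    rw [← this, mul_inv_cancel_left₀ h0.ne']
  have hmul : ∀ x y, φ (x * y) = φ x * φ y := by
    intro x y
    obtain ⟨N, hN, hN1, hN2⟩ := harch x
    -- p = (x + N + 1) / (2 N + 2)
    have hc : 0 < (2 * N + 2)⁻¹ := by positivity
    have hb1 := hp _ hN1
    have hb2 := hp _ hN2
    have hφa : ∀ r : ℝ, φ (algebraMap ℝ A r) = r := fun r => by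
      rw [Algebra.algebraMap_eq_smul_one, hs, h1, mul_one]
    rw [ha, hφa] at hb1
    rw [hsub, hφa] at hb2
    have hφp : φ ((2 * N + 2)⁻¹ • (algebraMap ℝ A N + x + 1)) = (2 * N + 2)⁻¹ * (N + φ x + 1) := by
      rw [hs, ha, ha, h1, hφa]
    have h1p : 1 - (2 * N + 2)⁻¹ • (algebraMap ℝ A N + x + 1) =
        (2 * N + 2)⁻¹ • (algebraMap ℝ A N - x + 1) := by
      have : (1 : A) = (2 * N + 2)⁻¹ • (algebraMap ℝ A (2 * N + 2)) := by
        rw [Algebra.algebraMap_eq_smul_one, smul_smul, inv_mul_cancel₀ (by positivity), one_smul]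
      nth_rewrite 1 [this]
      rw [← smul_sub]
      congr 1
      simp only [map_add, map_mul, map_ofNat]
      ring
    have := hmul1 ((2 * N + 2)⁻¹ • (algebraMap ℝ A N + x + 1))
      (hsm _ hc.le _ (P.add_mem hN1 P.one_mem))
      (by rw [h1p]; exact hsm _ hc.le _ (P.add_mem hN2 P.one_mem))
      (by rw [hφp]; exact mul_pos hc (by linarith))
      (by rw [hφp, inv_mul_lt_iff₀ (by positivity)]; linarith) y
    rw [hφp, smul_mul_assoc, hs, add_mul, add_mul, ha, ha, mul_assoc,
      mul_right_inj' hc.ne', one_mul, Algebra.algebraMap_eq_smul_one, smul_mul_assoc, hs,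
      one_mul] at this
    linarith
  let Φ : A →ₐ[ℝ] ℝ := AlgHom.ofLinearMap
    { toFun := φ, map_add' := ha, map_smul' := fun r x => by simp [hs] } h1 hmul
  have h2 : 0 < φ f := hf Φ hp
  have := hψmin' _ hφ₀
  linarith

theorem main_lemma (d m : ℕ) (a : Fin m → MvPolynomial (Fin d) ℝ)
    (f : MvPolynomial (Fin d) ℝ)
    (hf : ∀ x : Fin d → ℝ, (∀ j, 0 ≤ eval x (a j)) → 0 < eval x f)
    (l : Fin d → MvPolynomial (Fin d) ℝ) (hl : ∀ i, (l i).totalDegree ≤ 1)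
    (hgen : Algebra.adjoin ℝ (Set.range l) = (⊤ : Subalgebra ℝ (MvPolynomial (Fin d) ℝ)))
    (t : ℝ) (ht : 0 < t) :
    f ∈ SCone (Sum.elim l (Sum.elim a
        (fun _ : Unit => C t - (∑ i, l i) - (∑ j, a j)))
        : Fin d ⊕ (Fin m ⊕ Unit) → MvPolynomial (Fin d) ℝ) := by
  apply mem_SCone_of_adjoin
  set g : Fin d ⊕ (Fin m ⊕ Unit) → MvPolynomial (Fin d) ℝ := Sum.elim l (Sum.elim a
        (fun _ : Unit => C t - (∑ i, l i) - (∑ j, a j))) with hg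
  set P := Algebra.adjoin NNReal (Set.range g) with hP
  have hgP : ∀ i, g i ∈ P := fun i => Algebra.subset_adjoin ⟨i, rfl⟩
  have hlP : ∀ i, l i ∈ P := fun i => hgP (Sum.inl i)
  have haP : ∀ i, a i ∈ P := fun i => hgP (Sum.inr (Sum.inl i))
  have hqP : C t - (∑ i, l i) - (∑ j, a j) ∈ P := hgP (Sum.inr (Sum.inr ()))
  have hsm : ∀ r : ℝ, 0 ≤ r → ∀ p ∈ P, r • p ∈ P := fun r hr p hp =>
    P.smul_mem hp (⟨r, hr⟩ : NNReal)
  have halg : ∀ r : ℝ, 0 ≤ r → algebraMap ℝ (MvPolynomial (Fin d) ℝ) r ∈ P := fun r hr => by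
    rw [Algebra.algebraMap_eq_smul_one]; exact hsm r hr 1 P.one_mem
  apply rep_thm P
  · intro y
    have hy : y ∈ Algebra.adjoin ℝ (Set.range l) := by rw [hgen]; trivial
    induction hy using Algebra.adjoin_induction with
    | mem x hx =>
      obtain ⟨i, rfl⟩ := hx
      refine ⟨t, ht.le, P.add_mem (halg t ht.le) (hlP i), ?_⟩
      have : algebraMap ℝ (MvPolynomial (Fin d) ℝ) t - l i =
          (C t - (∑ i, l i) - (∑ j, a j)) + ∑ j ∈ Finset.univ.erase i, l j + ∑ j, a j := by
        rw [← Finset.add_sum_erase _ l (Finset.mem_univ i), algebraMap_eq]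
        ring
      rw [this]
      exact P.add_mem (P.add_mem hqP (P.sum_mem fun j _ => hlP j)) (P.sum_mem fun j _ => haP j)
    | algebraMap r =>
      refine ⟨|r|, abs_nonneg r, ?_, ?_⟩
      · rw [← map_add]; exact halg _ (by linarith [neg_abs_le r])
      · rw [← map_sub]; exact halg _ (by linarith [le_abs_self r])
    | add x y _ _ hx hy =>
      obtain ⟨N, hN, h1, h2⟩ := hx
      obtain ⟨M, hM, h3, h4⟩ := hy
      refine ⟨N + M, by positivity, ?_, ?_⟩
      · convert P.add_mem h1 h3 using 1
        rw [map_add]; ring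
      · convert P.add_mem h2 h4 using 1
        rw [map_add]; ring
    | mul x y _ _ hx hy =>
      obtain ⟨N, hN, h1, h2⟩ := hx
      obtain ⟨M, hM, h3, h4⟩ := hy
      refine ⟨N * M, by positivity, ?_, ?_⟩
      · convert hsm (1/2) (by norm_num) _ (P.add_mem (P.mul_mem h1 h3) (P.mul_mem h2 h4)) using 1
        have : ∀ z : MvPolynomial (Fin d) ℝ, z = (1 / 2 : ℝ) • (2 * z) := fun z => by
          rw [two_mul, ← two_smul ℝ z, smul_smul]; norm_num
        rw [this (_ + _), map_mul]; congr 1; ring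
      · convert hsm (1/2) (by norm_num) _ (P.add_mem (P.mul_mem h1 h4) (P.mul_mem h2 h3)) using 1
        have : ∀ z : MvPolynomial (Fin d) ℝ, z = (1 / 2 : ℝ) • (2 * z) := fun z => by
          rw [two_mul, ← two_smul ℝ z, smul_smul]; norm_num
        rw [this (_ - _), map_mul]; congr 1; ring
  · intro φ hφ
    have e : ∀ p, φ p = eval (fun i => φ (X i)) p := by
      intro p
      have : φ = aeval (fun i => φ (X i)) := by
        ext i; simp
      rw [this]
      simp [aeval_eq_eval]
    rw [e]
    apply hf
    intro j
    rw [← e]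
    exact hφ _ (haP j)
end

section
/- (Putinar's theorem, Archimedean linear case / Jacobi–Prestel) Let a_1,...,a_m ∈ ℝ[X] with S := {a_1 ≥ 0,...,a_m ≥ 0} nonempty and bounded. Suppose the quadratic module M(a) generated by a_1,...,a_m contains degree ≤ 1 polynomials l_1,...,l_k such that {l_1 ≥ 0,...,l_k ≥ 0} is bounded. Then every f ∈ ℝ[X] strictly positive on S belongs to M(a). -/
open Finset MvPolynomial

/-- `p` is a sum of squares. -/
def IsSOS {d : ℕ} (p : MvPolynomial (Fin d) ℝ) : Prop :=
  ∃ (k : ℕ) (q : Fin k → MvPolynomial (Fin d) ℝ), p = ∑ j, q j ^ 2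

/-- The quadratic module generated by a finite family `a : ι → ℝ[X]`. -/
def QM {d : ℕ} {ι : Type*} [Fintype ι] (a : ι → MvPolynomial (Fin d) ℝ) :
    Set (MvPolynomial (Fin d) ℝ) :=
  {f | ∃ (σ₀ : MvPolynomial (Fin d) ℝ) (σ : ι → MvPolynomial (Fin d) ℝ),
        IsSOS σ₀ ∧ (∀ i, IsSOS (σ i)) ∧ f = σ₀ + ∑ i, σ i * a i}

namespace JP

structure IsQ {A : Type*} [CommRing A] [Algebra ℝ A] (Q : Set A) : Prop where
  one : (1 : A) ∈ Q
  add : ∀ {a b}, a ∈ Q → b ∈ Q → a + b ∈ Q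
  sq : ∀ (g) {a}, a ∈ Q → g ^ 2 * a ∈ Q

section
variable {d : ℕ}
local notation "R" => MvPolynomial (Fin d) ℝ

lemma IsQ.const {Q : Set R} (hQ : IsQ Q) {c : ℝ} (hc : 0 ≤ c) : (C c : R) ∈ Q := by
  have := hQ.sq (C (Real.sqrt c)) hQ.one
  rwa [mul_one, ← C_pow, Real.sq_sqrt hc] at this

lemma IsQ.zero {Q : Set R} (hQ : IsQ Q) : (0 : R) ∈ Q := by
  simpa using hQ.const le_rfl

lemma IsQ.smul {Q : Set R} (hQ : IsQ Q) {c : ℝ} (hc : 0 ≤ c) {a : R} (ha : a ∈ Q) :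
    C c * a ∈ Q := by
  have := hQ.sq (C (Real.sqrt c)) ha
  rwa [← C_pow, Real.sq_sqrt hc] at this

lemma IsQ.sum {Q : Set R} (hQ : IsQ Q) {ι : Type*} (s : Finset ι) (g : ι → R)
    (h : ∀ i ∈ s, g i ∈ Q) : ∑ i ∈ s, g i ∈ Q :=
  Finset.sum_induction g (· ∈ Q) (fun _ _ => hQ.add) hQ.zero h

lemma IsQ.sos {Q : Set R} (hQ : IsQ Q) {s a : R} (hs : IsSOS s) (ha : a ∈ Q) : s * a ∈ Q := by
  obtain ⟨k, q, rfl⟩ := hs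
  rw [Finset.sum_mul]
  exact hQ.sum _ _ (fun i _ => hQ.sq _ ha)

lemma IsQ.sos' {Q : Set R} (hQ : IsQ Q) {s : R} (hs : IsSOS s) : s ∈ Q := by
  simpa using hQ.sos hs hQ.one

lemma sos_zero : IsSOS (0 : R) := ⟨0, Fin.elim0, by simp⟩

lemma sos_sq (g : R) : IsSOS (g ^ 2) := ⟨1, fun _ => g, by simp⟩

lemma sos_one : IsSOS (1 : R) := by simpa using sos_sq (1 : R)

lemma sos_add {s t : R} (hs : IsSOS s) (ht : IsSOS t) : IsSOS (s + t) := by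
  obtain ⟨k, q, rfl⟩ := hs
  obtain ⟨k', q', rfl⟩ := ht
  refine ⟨k + k', Fin.append q q', ?_⟩
  simp [Fin.sum_univ_add]

lemma sos_sq_mul (g : R) {s : R} (hs : IsSOS s) : IsSOS (g ^ 2 * s) := by
  obtain ⟨k, q, rfl⟩ := hs
  refine ⟨k, fun j => g * q j, ?_⟩
  simp [Finset.mul_sum, mul_pow]

lemma isQ_QM {m : ℕ} (a : Fin m → R) : IsQ (QM a) where
  one := ⟨1, fun _ => 0, sos_one, fun _ => sos_zero, by simp⟩
  add := by
    rintro _ _ ⟨s, t, hs, ht, rfl⟩ ⟨s', t', hs', ht', rfl⟩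
    refine ⟨s + s', fun i => t i + t' i, sos_add hs hs', fun i => sos_add (ht i) (ht' i), ?_⟩
    simp only [add_mul, Finset.sum_add_distrib]; ring
  sq := by
    rintro g _ ⟨s, t, hs, ht, rfl⟩
    refine ⟨g ^ 2 * s, fun i => g ^ 2 * t i, sos_sq_mul g hs, fun i => sos_sq_mul g (ht i), ?_⟩
    simp only [mul_add, Finset.mul_sum, mul_assoc]

lemma gen_mem {m : ℕ} (a : Fin m → R) (i : Fin m) : a i ∈ QM a := by
  classical
  refine ⟨0, fun j => if j = i then 1 else 0, sos_zero, fun j => ?_, by simp⟩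
  dsimp only
  split_ifs
  · exact sos_one
  · exact sos_zero

lemma eval_sos {s : R} (hs : IsSOS s) (x : Fin d → ℝ) : 0 ≤ eval x s := by
  obtain ⟨k, q, rfl⟩ := hs
  rw [map_sum]
  exact Finset.sum_nonneg (fun i _ => by rw [map_pow]; positivity)

lemma eval_QM {m : ℕ} (a : Fin m → R) {f : R} (hf : f ∈ QM a) (x : Fin d → ℝ)
    (hx : ∀ j, 0 ≤ eval x (a j)) : 0 ≤ eval x f := by
  obtain ⟨s, t, hs, ht, rfl⟩ := hf
  rw [map_add, map_sum]
  refine add_nonneg (eval_sos hs x) (Finset.sum_nonneg fun i _ => ?_)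
  rw [map_mul]
  exact mul_nonneg (eval_sos (ht i) x) (hx i)

/-- adjoin an element -/
def adj (Q : Set R) (a : R) : Set R := {f | ∃ q ∈ Q, ∃ s, IsSOS s ∧ f = q + s * a}

lemma isQ_adj {Q : Set R} (hQ : IsQ Q) (a : R) : IsQ (adj Q a) where
  one := ⟨1, hQ.one, 0, sos_zero, by simp⟩
  add := by
    rintro _ _ ⟨q, hq, s, hs, rfl⟩ ⟨q', hq', s', hs', rfl⟩
    exact ⟨q + q', hQ.add hq hq', s + s', sos_add hs hs', by ring⟩
  sq := by
    rintro g _ ⟨q, hq, s, hs, rfl⟩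
    exact ⟨g ^ 2 * q, hQ.sq g hq, g ^ 2 * s, sos_sq_mul g hs, by ring⟩

lemma sub_adj {Q : Set R} (a : R) : Q ⊆ adj Q a := fun q hq => ⟨q, hq, 0, sos_zero, by simp⟩

lemma mem_adj {Q : Set R} (hQ : IsQ Q) (a : R) : a ∈ adj Q a :=
  ⟨0, hQ.zero, 1, sos_one, by simp⟩

lemma C_half_mul (a : R) : C (1/2 : ℝ) * (a + a) = a := by
  rw [← two_mul, ← mul_assoc]
  have : (2 : R) = C 2 := (map_ofNat C 2).symm
  rw [this, ← C_mul]; norm_num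

/-- the support is an ideal -/
lemma supp_mul {Q : Set R} (hQ : IsQ Q) {a : R} (ha : a ∈ Q) (ha' : -a ∈ Q) (b : R) :
    b * a ∈ Q := by
  have h1 := hQ.sq (b + 1) ha
  have h2 := hQ.sq b ha'
  have h3 := hQ.add (hQ.add h1 h2) ha'
  have h4 : (b + 1) ^ 2 * a + b ^ 2 * -a + -a = b * a + b * a := by ring
  rw [h4] at h3
  rw [← C_half_mul (b * a)]
  exact hQ.smul (by norm_num) h3

lemma exists_max {Q : Set R} (hQ : IsQ Q) (hneg : (-1 : R) ∉ Q) :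
    ∃ P : Set R, IsQ P ∧ (-1 : R) ∉ P ∧ Q ⊆ P ∧ ∀ a, a ∈ P ∨ -a ∈ P := by
  obtain ⟨P, hQP, hP⟩ := zorn_subset_nonempty {P : Set R | IsQ P ∧ (-1 : R) ∉ P} (by
    intro c hc hch hne
    refine ⟨⋃₀ c, ⟨⟨?_, ?_, ?_⟩, ?_⟩, fun s hs => Set.subset_sUnion_of_mem hs⟩
    · obtain ⟨s, hs⟩ := hne
      exact ⟨s, hs, (hc hs).1.one⟩
    · rintro a b ⟨s, hs, has⟩ ⟨t, ht, hbt⟩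
      rcases hch.total hs ht with h | h
      · exact ⟨t, ht, (hc ht).1.add (h has) hbt⟩
      · exact ⟨s, hs, (hc hs).1.add has (h hbt)⟩
    · rintro g a ⟨s, hs, has⟩
      exact ⟨s, hs, (hc hs).1.sq g has⟩
    · rintro ⟨s, hs, has⟩
      exact (hc hs).2 has) Q ⟨hQ, hneg⟩
  have hPQ : IsQ P := hP.prop.1
  refine ⟨P, hPQ, hP.prop.2, hQP, fun a => ?_⟩
  have key : ∀ b, b ∉ P → (-1 : R) ∈ adj P b := by
    intro b hb
    by_contra hcon
    exact hb (hP.le_of_ge (y := adj P b) ⟨isQ_adj hPQ b, hcon⟩ (sub_adj b) (mem_adj hPQ b))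
  by_contra hcon
  push Not at hcon
  obtain ⟨q, hq, s, hs, h1⟩ := key a hcon.1
  obtain ⟨q', hq', t, ht, h2⟩ := key (-a) hcon.2
  have hs' : -s ∈ P := by
    have : -s = t + t * q + s * q' := by linear_combination t * h1 + s * h2
    rw [this]
    exact hPQ.add (hPQ.add (hPQ.sos' ht) (hPQ.sos ht hq)) (hPQ.sos hs hq')
  apply hP.prop.2
  rw [h1, mul_comm]
  exact hPQ.add hq (supp_mul hPQ (hPQ.sos' hs) hs' a)

lemma C_cancel {Q : Set R} (hQ : IsQ Q) {c : ℝ} (hc : 0 < c) {a : R} (h : C c * a ∈ Q) :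
    a ∈ Q := by
  have := hQ.smul (inv_nonneg.2 hc.le) h
  rwa [← mul_assoc, ← C_mul, inv_mul_cancel₀ hc.ne', C_1, one_mul] at this

/-- `N ± a ∈ Q` implies `N² - a² ∈ Q`. -/
lemma sq_bound {Q : Set R} (hQ : IsQ Q) {N : ℝ} (hN : 0 < N) {a : R}
    (h1 : C N + a ∈ Q) (h2 : C N - a ∈ Q) : C (N ^ 2) - a ^ 2 ∈ Q := by
  apply C_cancel hQ (c := 2 * N) (by positivity)
  have := hQ.add (hQ.sq (C N - a) h1) (hQ.sq (C N + a) h2)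
  convert this using 1
  simp only [C_mul, C_pow, map_ofNat]
  ring

lemma mono_const {Q : Set R} (hQ : IsQ Q) {N N' : ℝ} (h : N ≤ N') {a : R}
    (h1 : C N + a ∈ Q) : C N' + a ∈ Q := by
  have := hQ.add h1 (hQ.const (sub_nonneg.2 h))
  convert this using 1
  simp only [C_sub]; ring

/-- archimedean bounded elements -/
def Bd (Q : Set R) (a : R) : Prop := ∃ N : ℝ, 0 < N ∧ C N + a ∈ Q ∧ C N - a ∈ Q

lemma Bd.add {Q : Set R} (hQ : IsQ Q) {a b : R} (ha : Bd Q a) (hb : Bd Q b) : Bd Q (a + b) := by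
  obtain ⟨N, hN, h1, h2⟩ := ha
  obtain ⟨N', hN', h1', h2'⟩ := hb
  refine ⟨N + N', by positivity, ?_, ?_⟩
  · convert hQ.add h1 h1' using 1; simp only [C_add]; ring
  · convert hQ.add h2 h2' using 1; simp only [C_add]; ring

lemma Bd.sq {Q : Set R} (hQ : IsQ Q) {a : R} (ha : Bd Q a) : Bd Q (a ^ 2) := by
  obtain ⟨N, hN, h1, h2⟩ := ha
  refine ⟨N ^ 2, by positivity, hQ.add (hQ.const (by positivity)) ?_, sq_bound hQ hN h1 h2⟩
  simpa using hQ.sq a hQ.one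

lemma Bd.neg {Q : Set R} {a : R} (ha : Bd Q a) : Bd Q (-a) := by
  obtain ⟨N, hN, h1, h2⟩ := ha
  exact ⟨N, hN, by simpa [sub_eq_add_neg] using h2, by simpa using h1⟩

lemma Bd.const {Q : Set R} (hQ : IsQ Q) (c : ℝ) : Bd Q (C c) := by
  refine ⟨|c| + 1, by positivity, ?_, ?_⟩
  · rw [← C_add]; exact hQ.const (by linarith [neg_abs_le c])
  · rw [← C_sub]; exact hQ.const (by linarith [le_abs_self c])

lemma Bd.half {Q : Set R} (hQ : IsQ Q) {a : R} (ha : Bd Q (a + a)) : Bd Q a := by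
  obtain ⟨N, hN, h1, h2⟩ := ha
  refine ⟨N / 2, by positivity, ?_, ?_⟩
  · convert hQ.smul (c := 1/2) (by norm_num) h1 using 1
    rw [mul_add, C_half_mul, ← C_mul]; congr 2; ring
  · convert hQ.smul (c := 1/2) (by norm_num) h2 using 1
    rw [mul_sub, C_half_mul, ← C_mul]; congr 2; ring

lemma Bd.mul {Q : Set R} (hQ : IsQ Q) {a b : R} (ha : Bd Q a) (hb : Bd Q b) : Bd Q (a * b) := by
  apply Bd.half hQ
  have := ((ha.add hQ hb).sq hQ).add hQ ((ha.sq hQ).neg.add hQ (hb.sq hQ).neg)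
  convert this using 1
  ring

lemma Bd.all {Q : Set R} (hQ : IsQ Q) (hX : ∀ i, Bd Q (X i)) (p : R) : Bd Q p := by
  induction p using MvPolynomial.induction_on with
  | C c => exact Bd.const hQ c
  | add p q hp hq => exact hp.add hQ hq
  | mul_X p i hp => exact hp.mul hQ (hX i)

/-- infinitesimals -/
def Inf (Q : Set R) (a : R) : Prop := ∀ e : ℝ, 0 < e → C e + a ∈ Q ∧ C e - a ∈ Q

lemma Inf.neg {Q : Set R} {a : R} (ha : Inf Q a) : Inf Q (-a) := fun e he =>
  ⟨by simpa [sub_eq_add_neg] using (ha e he).2, by simpa using (ha e he).1⟩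

lemma Inf.add {Q : Set R} (hQ : IsQ Q) {a b : R} (ha : Inf Q a) (hb : Inf Q b) :
    Inf Q (a + b) := by
  intro e he
  have h1 := ha (e/2) (by positivity)
  have h2 := hb (e/2) (by positivity)
  have h3 : (C e : R) = C (e/2) + C (e/2) := by rw [← C_add]; congr 1; ring
  rw [h3]
  constructor
  · convert hQ.add h1.1 h2.1 using 1; ring
  · convert hQ.add h1.2 h2.2 using 1; ring

lemma Inf.mul_aux {Q : Set R} (hQ : IsQ Q) {a b : R} (ha : Inf Q a) (hb : Bd Q b)
    (e : ℝ) (he : 0 < e) : C e + a * b ∈ Q := by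
  obtain ⟨N, hN, h1, h2⟩ := hb
  have hb2 := sq_bound hQ hN h1 h2
  -- 2ab = (t a + b/t)^2 - t^2 a^2 - b^2/t^2, with N/t = δ, δ^2 = e
  set δ := Real.sqrt e with hδ
  have hδ0 : 0 < δ := Real.sqrt_pos.2 he
  have hδ2 : δ ^ 2 = e := Real.sq_sqrt he.le
  have hη : 0 < δ ^ 2 / N := by positivity
  have ha' := ha (δ ^ 2 / N) hη
  have ha2 := sq_bound hQ hη ha'.1 ha'.2
  have s1 := hQ.sq (C (N / δ) * a + C (δ / N) * b) hQ.one
  have s2 := hQ.sq (C (N / δ)) ha2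
  have s3 := hQ.sq (C (δ / N)) hb2
  have := hQ.add s1 (hQ.add s2 s3)
  apply C_cancel hQ (c := 2) (by norm_num)
  convert this using 1
  have e1 : (C (N/δ) : R) * C (δ/N) = 1 := by
    rw [← C_mul, ← C_1]; congr 1; field_simp
  have e2 : (C (N/δ) : R) ^ 2 * C ((δ^2/N)^2) = C e := by
    rw [← C_pow, ← C_mul]; congr 1; rw [← hδ2]; field_simp
  have e3 : (C (δ/N) : R) ^ 2 * C (N^2) = C e := by
    rw [← C_pow, ← C_mul]; congr 1; rw [← hδ2]; field_simp
  rw [map_ofNat]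
  linear_combination (-2 * a * b) * e1 - e2 - e3

lemma Inf.mul {Q : Set R} (hQ : IsQ Q) {a b : R} (ha : Inf Q a) (hb : Bd Q b) :
    Inf Q (a * b) := by
  intro e he
  refine ⟨ha.mul_aux hQ hb e he, ?_⟩
  have := ha.mul_aux hQ hb.neg e he
  simpa [sub_eq_add_neg] using this

lemma Inf.zero {Q : Set R} (hQ : IsQ Q) : Inf Q (0 : R) := fun e he => by
  simpa using hQ.const he.le

lemma no_neg {Q : Set R} (hQ : IsQ Q) (hneg : (-1 : R) ∉ Q) {c : ℝ} (h : C c ∈ Q) : 0 ≤ c := by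
  by_contra hc
  push Not at hc
  apply hneg
  apply C_cancel hQ (c := -c) (by linarith)
  simpa using h

lemma exists_std {Q : Set R} (hQ : IsQ Q) (hneg : (-1 : R) ∉ Q) (htot : ∀ a, a ∈ Q ∨ -a ∈ Q)
    {a : R} (ha : Bd Q a) : ∃ r : ℝ, Inf Q (a - C r) := by
  obtain ⟨N, hN, h1, h2⟩ := ha
  set T : Set ℝ := {r | a - C r ∈ Q} with hT
  have hTne : T.Nonempty := ⟨-N, by simpa [hT, add_comm] using h1⟩
  have hTb : BddAbove T := by
    refine ⟨N, fun r hr => ?_⟩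
    have := hQ.add hr h2
    have e : a - C r + (C N - a) = C (N - r) := by rw [C_sub]; ring
    rw [e] at this
    linarith [no_neg hQ hneg this]
  refine ⟨sSup T, fun e he => ⟨?_, ?_⟩⟩
  · obtain ⟨r, hr, hlt⟩ := exists_lt_of_lt_csSup hTne (sub_lt_self (sSup T) he)
    have h3 : (C (-r) : R) + a ∈ Q := by
      have : a - C r ∈ Q := hr
      simpa [sub_eq_add_neg, add_comm] using this
    have := mono_const hQ (N' := e - sSup T) (by linarith) h3
    convert this using 1
    rw [C_sub]; ring
  · rcases htot (a - C (sSup T + e)) with h | h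
    · have := le_csSup hTb h
      linarith
    · convert h using 1
      rw [C_add]; ring

lemma exists_point {Q : Set R} (hQ : IsQ Q) (hneg : (-1 : R) ∉ Q) (hX : ∀ i, Bd Q (X i)) :
    ∃ x : Fin d → ℝ, ∀ q ∈ Q, 0 ≤ eval x q := by
  obtain ⟨P, hP, hPneg, hQP, htot⟩ := exists_max hQ hneg
  have hXP : ∀ i, Bd P (X i) := fun i => by
    obtain ⟨N, hN, h1, h2⟩ := hX i
    exact ⟨N, hN, hQP h1, hQP h2⟩
  choose x hx using fun i => exists_std hP hPneg htot (hXP i)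
  have key : ∀ q : R, Inf P (q - C (eval x q)) := by
    intro q
    induction q using MvPolynomial.induction_on with
    | C c => simpa using Inf.zero hP
    | add p q hp hq =>
      convert hp.add hP hq using 1
      simp only [map_add]; ring
    | mul_X p i hp =>
      convert (hp.mul hP (hXP i)).add hP ((hx i).mul hP (Bd.const hP (eval x p))) using 1
      simp only [map_mul, eval_X]; ring
  refine ⟨x, fun q hq => ?_⟩
  by_contra hc
  push Not at hc
  have h1 := (key q (-(eval x q)/2) (by linarith)).2
  have h2 := hP.add h1 (hQP hq)
  have e : C (-(eval x q)/2) - (q - C (eval x q)) + q = C (eval x q / 2) := by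
    have : (eval x q)/2 = -(eval x q)/2 + eval x q := by ring
    rw [this, C_add]; ring
  rw [e] at h2
  linarith [no_neg hP hPneg h2]

lemma step {Q : Set R} (hQ : IsQ Q) (hB : ∀ p, Bd Q p) {f p : R} (hp : IsSOS p)
    (h : p * f - 1 ∈ Q) : f ∈ Q := by
  obtain ⟨N1, h1, -, hk1⟩ := hB p
  obtain ⟨N2, h2, -, hk2⟩ := hB (p ^ 2 * f)
  obtain ⟨r0, hr0, hf0, -⟩ := hB f
  set k := max N1 N2 with hk
  have hk0 : 0 < k := lt_of_lt_of_le h1 (le_max_left _ _)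
  have g1 : C (2 * k) - p ∈ Q := by
    rw [sub_eq_add_neg] at hk1 ⊢
    exact mono_const hQ (by linarith [le_max_left N1 N2]) hk1
  have g2 : C k - p ^ 2 * f ∈ Q := by
    rw [sub_eq_add_neg] at hk2 ⊢
    exact mono_const hQ (le_max_right N1 N2) hk2
  have st : ∀ r : ℝ, 0 ≤ r → C r + f ∈ Q → C (r - 1 / k) + f ∈ Q := by
    intro r hr hrf
    apply C_cancel hQ (c := k ^ 2) (by positivity)
    have := hQ.add (hQ.add (hQ.sq (C k - p) hrf) (hQ.smul (c := 2 * k) (by positivity) h))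
      (hQ.add (hQ.smul hr (hQ.sos hp g1)) g2)
    convert this using 1
    have e : (C (k ^ 2) : R) * C (r - 1/k) = C k ^ 2 * C r - C k := by
      rw [← C_pow, ← C_mul, ← C_mul, ← C_sub]; congr 1; field_simp
    rw [mul_add, e]
    simp only [C_mul, C_pow, map_ofNat]
    ring
  have it : ∀ n : ℕ, (C (max 0 (r0 - n / k)) : R) + f ∈ Q := by
    intro n
    induction n with
    | zero => simpa [max_eq_right hr0.le] using hf0
    | succ n ih =>
      refine mono_const hQ ?_ (st _ (le_max_left _ _) ih)
      have hk' : 0 < 1 / k := by positivity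
      have : r0 - ((n + 1 : ℕ) : ℝ) / k = r0 - n / k - 1 / k := by push_cast; ring
      rw [this, sub_le_iff_le_add]
      refine max_le ?_ ?_
      · linarith [le_max_left 0 (r0 - n / k - 1 / k)]
      · linarith [le_max_right 0 (r0 - n / k - 1 / k)]
  obtain ⟨n, hn⟩ := exists_nat_ge (r0 * k)
  have := it n
  have h3 : r0 ≤ n / k := by rwa [le_div_iff₀ hk0]
  rw [max_eq_left (by linarith)] at this
  simpa using this

lemma affine_form {l : R} (h : l.totalDegree ≤ 1) :
    l = C (coeff 0 l) + ∑ j, C (coeff (Finsupp.single j 1) l) * X j := by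
  classical
  ext m
  simp only [coeff_add, coeff_C, coeff_sum, coeff_C_mul, coeff_X]
  by_cases hm : m ∈ l.support
  · have h1 := (le_totalDegree hm).trans h
    by_cases h0 : m = 0
    · subst h0; simp
    · obtain ⟨j, hj⟩ : ∃ j, m j ≠ 0 := by
        by_contra hcon; push Not at hcon; exact h0 (Finsupp.ext hcon)
      have hms : m = Finsupp.single j 1 := by
        have h2 : m.sum (fun _ e => e) = ∑ i, m i := by
          rw [Finsupp.sum_fintype]; simp
        rw [h2] at h1
        ext i
        by_cases hij : i = j
        · subst hij
          have := Finset.single_le_sum (f := fun i => m i) (fun i _ => Nat.zero_le _) (mem_univ i)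
          simp at this ⊢; omega
        · have := Finset.add_le_sum (f := fun i => m i) (fun i _ => Nat.zero_le _)
            (mem_univ i) (mem_univ j) hij
          simp [Finsupp.single_apply, Ne.symm hij] at this ⊢; omega
      subst hms
      rw [if_neg (Ne.symm h0)]
      simp [Finsupp.single_left_inj]
  · rw [mem_support_iff, not_not] at hm
    rw [hm]
    by_cases h0 : m = 0
    · subst h0; simp [hm]
    · symm
      rw [if_neg (Ne.symm h0), zero_add]
      apply Finset.sum_eq_zero
      intro j _
      split_ifs with hj
      · rw [hj, hm]; simp
      · simp

end

lemma dense_convex {d : ℕ} {D : Set (Fin d → ℝ)} (hD : Convex ℝ D) (hc : closure D = Set.univ) :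
    D = Set.univ := by
  have hne : (interior D).Nonempty := by
    rw [hD.interior_nonempty_iff_affineSpan_eq_top]
    have hcl : IsClosed (affineSpan ℝ D : Set (Fin d → ℝ)) :=
      AffineSubspace.closed_of_finiteDimensional _
    have := closure_minimal (subset_affineSpan ℝ D) hcl
    rw [hc] at this
    ext x; simpa using this (Set.mem_univ x)
  have := hD.interior_closure_eq_interior_of_nonempty_interior hne
  rw [hc, interior_univ] at this
  exact Set.eq_univ_of_univ_subset (this ▸ interior_subset)

lemma cone_univ {d k : ℕ} (L : Fin k → Fin d → ℝ)
    (h : ∀ v : Fin d → ℝ, (∀ i, 0 ≤ ∑ j, L i j * v j) → v = 0) (y : Fin d → ℝ) :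
    ∃ c : Fin k → ℝ, (∀ i, 0 ≤ c i) ∧ y = ∑ i, c i • L i := by
  set D : Set (Fin d → ℝ) := {y | ∃ c : Fin k → ℝ, (∀ i, 0 ≤ c i) ∧ y = ∑ i, c i • L i} with hDdef
  have hD : Convex ℝ D := by
    rintro _ ⟨c, hc, rfl⟩ _ ⟨c', hc', rfl⟩ s t hs ht -
    refine ⟨fun i => s * c i + t * c' i, fun i => ?_, ?_⟩
    · have := hc i; have := hc' i; positivity
    · simp only [Finset.smul_sum, add_smul, Finset.sum_add_distrib, smul_smul]
  suffices closure D = Set.univ by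
    have h2 := dense_convex hD this
    have : y ∈ D := h2 ▸ Set.mem_univ y
    exact this
  by_contra hcon
  obtain ⟨y0, hy0⟩ := (Set.ne_univ_iff_exists_notMem _).1 hcon
  obtain ⟨φ, u, hu1, hu2⟩ := geometric_hahn_banach_point_closed hD.closure isClosed_closure hy0
  have h0 : (0 : Fin d → ℝ) ∈ D := ⟨0, by simp, by simp⟩
  have hu0 : u < 0 := by simpa using hu2 0 (subset_closure h0)
  have hφ : ∀ z, φ z = ∑ j, z j * φ (Pi.single j 1) := by
    intro z
    conv_lhs => rw [← Finset.univ_sum_single z]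
    rw [map_sum]
    refine Finset.sum_congr rfl fun j _ => ?_
    have : (Pi.single j (z j) : Fin d → ℝ) = z j • Pi.single j 1 := by
      rw [← Pi.single_smul]; simp
    rw [this, map_smul, smul_eq_mul]
  have hL : ∀ i, 0 ≤ φ (L i) := by
    intro i
    by_contra hc
    push Not at hc
    have hm : (u / φ (L i)) • L i ∈ D := by
      refine ⟨Pi.single i (u / φ (L i)), fun j => ?_, ?_⟩
      · by_cases hj : j = i
        · subst hj; simpa using (div_pos_of_neg_of_neg hu0 hc).le
        · simp [hj]
      · rw [Finset.sum_eq_single i] <;> simp +contextual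
    have := hu2 _ (subset_closure hm)
    rw [map_smul, smul_eq_mul, div_mul_cancel₀ _ hc.ne] at this
    exact lt_irrefl _ this
  have hv := h (fun j => φ (Pi.single j 1)) (fun i => by rw [← hφ]; exact hL i)
  have : φ y0 = 0 := by
    rw [hφ]
    refine Finset.sum_eq_zero fun j _ => ?_
    have := congrFun hv j
    simp at this
    simp [this]
  linarith

end JP

open JP in
theorem jacobi_prestel (d m : ℕ) (a : Fin m → MvPolynomial (Fin d) ℝ)
    (hne : {x : Fin d → ℝ | ∀ j, 0 ≤ eval x (a j)}.Nonempty)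
    (hbdd : Bornology.IsBounded {x : Fin d → ℝ | ∀ j, 0 ≤ eval x (a j)})
    (k : ℕ) (hk : 1 ≤ k) (l : Fin k → MvPolynomial (Fin d) ℝ)
    (hldeg : ∀ i, (l i).totalDegree ≤ 1)
    (hlM : ∀ i, l i ∈ QM a)
    (hlbdd : Bornology.IsBounded {x : Fin d → ℝ | ∀ i, 0 ≤ eval x (l i)})
    (f : MvPolynomial (Fin d) ℝ)
    (hf : ∀ x : Fin d → ℝ, (∀ j, 0 ≤ eval x (a j)) → 0 < eval x f) :
    f ∈ QM a := by
  have hQ := isQ_QM a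
  obtain ⟨x0, hx0⟩ := hne
  have hl0 : ∀ i, 0 ≤ eval x0 (l i) := fun i => eval_QM a (hlM i) x0 hx0
  set L : Fin k → Fin d → ℝ := fun i j => coeff (Finsupp.single j 1) (l i) with hL
  have hform : ∀ i, l i = C (coeff 0 (l i)) + ∑ j, C (L i j) * X j := fun i => affine_form (hldeg i)
  have hev : ∀ i x, eval x (l i) = coeff 0 (l i) + ∑ j, L i j * x j := by
    intro i x
    conv_lhs => rw [hform i]
    simp
  have hcone : ∀ v : Fin d → ℝ, (∀ i, 0 ≤ ∑ j, L i j * v j) → v = 0 := by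
    intro v hv
    by_contra hv0
    obtain ⟨B, hB⟩ := hlbdd.exists_norm_le
    have hvn : 0 < ‖v‖ := norm_pos_iff.2 hv0
    have hB0 : 0 ≤ B := (norm_nonneg _).trans (hB x0 hl0)
    set t := (B + ‖x0‖ + 1) / ‖v‖ with ht
    have ht0 : 0 ≤ t := by positivity
    have hmem := hB (x0 + t • v) (by
      intro i
      have e : eval (x0 + t • v) (l i) = eval x0 (l i) + t * ∑ j, L i j * v j := by
        rw [hev, hev, Finset.mul_sum, add_assoc, ← Finset.sum_add_distrib]
        congr 1
        refine Finset.sum_congr rfl fun j _ => ?_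
        simp; ring
      rw [e]
      exact add_nonneg (hl0 i) (mul_nonneg ht0 (hv i)))
    have h1 : ‖t • v‖ = B + ‖x0‖ + 1 := by
      rw [norm_smul, Real.norm_of_nonneg ht0, ht, div_mul_cancel₀ _ hvn.ne']
    have h2 : ‖t • v‖ ≤ ‖x0 + t • v‖ + ‖x0‖ := by
      have := norm_sub_le (x0 + t • v) x0
      simpa using this
    linarith
  have hlin : ∀ y : Fin d → ℝ, ∃ c : ℝ, C c + ∑ j, C (y j) * X j ∈ QM a := by
    intro y
    obtain ⟨c, hc, rfl⟩ := cone_univ L hcone y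
    refine ⟨∑ i, c i * coeff 0 (l i), ?_⟩
    have := hQ.sum univ (fun i => C (c i) * l i) (fun i _ => hQ.smul (hc i) (hlM i))
    convert this using 1
    have e : ∀ i, C (c i) * l i = C (c i * coeff 0 (l i)) + ∑ j, C (c i * L i j) * X j := by
      intro i
      conv_lhs => rw [hform i]
      simp only [mul_add, Finset.mul_sum, C_mul, mul_assoc]
    simp only [e, Finset.sum_add_distrib, map_sum, Finset.sum_apply, Pi.smul_apply, smul_eq_mul,
      Finset.sum_mul]
    rw [Finset.sum_comm]
  have hX : ∀ i, Bd (QM a) (X i) := by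
    intro i
    obtain ⟨c, hc⟩ := hlin (Pi.single i 1)
    obtain ⟨c', hc'⟩ := hlin (Pi.single i (-1))
    have e1 : ∀ r : ℝ, ∑ j, C ((Pi.single i r : Fin d → ℝ) j) * (X j : MvPolynomial (Fin d) ℝ)
        = C r * X i := by
      intro r
      rw [Finset.sum_eq_single i] <;> simp +contextual
    rw [e1] at hc hc'
    refine ⟨max 1 (max c c'), lt_of_lt_of_le one_pos (le_max_left _ _), ?_, ?_⟩
    · refine mono_const hQ ?_ (by simpa using hc)
      exact (le_max_left c c').trans (le_max_right _ _)
    · rw [sub_eq_add_neg]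
      refine mono_const hQ ?_ (by simpa using hc')
      exact (le_max_right c c').trans (le_max_right _ _)
  have hB := Bd.all hQ hX
  by_cases hneg : (-1 : MvPolynomial (Fin d) ℝ) ∈ adj (QM a) (-f)
  · obtain ⟨q, hq, s, hs, h⟩ := hneg
    refine step hQ hB hs ?_
    have : s * f - 1 = q := by linear_combination h
    rwa [this]
  · exfalso
    obtain ⟨x, hx⟩ := exists_point (isQ_adj hQ (-f)) hneg (fun i => by
      obtain ⟨N, hN, h1, h2⟩ := hX i
      exact ⟨N, hN, sub_adj _ h1, sub_adj _ h2⟩)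
    have h1 := hf x (fun j => hx _ (sub_adj _ (gen_mem a j)))
    have h2 := hx _ (mem_adj hQ (-f))
    rw [map_neg] at h2
    linarith
end

section
/- (Putinar's positivstellensatz) Let a_1,...,a_m ∈ ℝ[X] with S := {a_1 ≥ 0,...,a_m ≥ 0} nonempty and bounded. Suppose there exists g in the quadratic module M(a) generated by a_1,...,a_m such that {x : g(x) ≥ 0} is bounded. Then every f ∈ ℝ[X] strictly positive on S belongs to M(a). -/
open Finset MvPolynomial

open Finset MvPolynomial

/-- preordering axioms -/
structure IsPre {A : Type*} [CommRing A] (T : Set A) : Prop where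
  add : ∀ {x y}, x ∈ T → y ∈ T → x + y ∈ T
  mul : ∀ {x y}, x ∈ T → y ∈ T → x * y ∈ T
  sq : ∀ x, x * x ∈ T

/-- maximal proper preordering -/
structure IsMaxPre {A : Type*} [CommRing A] (Q : Set A) : Prop extends IsPre Q where
  neg_one : (-1 : A) ∉ Q
  max : ∀ Q' : Set A, IsPre Q' → (-1 : A) ∉ Q' → Q ⊆ Q' → Q' ⊆ Q

lemma IsPre.exists_max {A : Type*} [CommRing A] {T : Set A} (hT : IsPre T) (h1 : (-1 : A) ∉ T) :
    ∃ Q, T ⊆ Q ∧ IsMaxPre Q := by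
  obtain ⟨Q, hTQ, hQ⟩ := zorn_subset_nonempty {Q : Set A | IsPre Q ∧ (-1 : A) ∉ Q} (by
    intro c hc hchain hne
    refine ⟨⋃₀ c, ⟨⟨?_, ?_, ?_⟩, ?_⟩, fun s hs => Set.subset_sUnion_of_mem hs⟩
    · rintro x y ⟨s, hs, hx⟩ ⟨t, ht, hy⟩
      rcases hchain.total hs ht with h | h
      · exact ⟨t, ht, (hc ht).1.add (h hx) hy⟩
      · exact ⟨s, hs, (hc hs).1.add hx (h hy)⟩
    · rintro x y ⟨s, hs, hx⟩ ⟨t, ht, hy⟩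
      rcases hchain.total hs ht with h | h
      · exact ⟨t, ht, (hc ht).1.mul (h hx) hy⟩
      · exact ⟨s, hs, (hc hs).1.mul hx (h hy)⟩
    · intro x
      obtain ⟨s, hs⟩ := hne
      exact ⟨s, hs, (hc hs).1.sq x⟩
    · rintro ⟨s, hs, hx⟩
      exact (hc hs).2 hx) T ⟨hT, h1⟩
  exact ⟨Q, hTQ, hQ.prop.1, hQ.prop.2, fun Q' h1 h2 h3 => hQ.le_of_ge ⟨h1, h2⟩ h3⟩

lemma IsPre.zero {A : Type*} [CommRing A] {T : Set A} (hT : IsPre T) : (0 : A) ∈ T := by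
  simpa using hT.sq 0
lemma IsPre.one {A : Type*} [CommRing A] {T : Set A} (hT : IsPre T) : (1 : A) ∈ T := by
  simpa using hT.sq 1

lemma IsPre.adjoin {A : Type*} [CommRing A] {T : Set A} (hT : IsPre T) (x : A) :
    IsPre {z | ∃ a ∈ T, ∃ b ∈ T, z = a + x * b} := by
  refine ⟨?_, ?_, ?_⟩
  · rintro _ _ ⟨a, ha, b, hb, rfl⟩ ⟨c, hc, d, hd, rfl⟩
    exact ⟨a + c, hT.add ha hc, b + d, hT.add hb hd, by ring⟩
  · rintro _ _ ⟨a, ha, b, hb, rfl⟩ ⟨c, hc, d, hd, rfl⟩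
    exact ⟨a * c + (x * x) * (b * d), hT.add (hT.mul ha hc) (hT.mul (hT.sq x) (hT.mul hb hd)),
      a * d + b * c, hT.add (hT.mul ha hd) (hT.mul hb hc), by ring⟩
  · intro y
    exact ⟨y * y, hT.sq y, 0, hT.zero, by ring⟩

lemma IsMaxPre.of_not_mem {A : Type*} [CommRing A] {Q : Set A} (hQ : IsMaxPre Q) {x : A}
    (hx : x ∉ Q) : ∃ a ∈ Q, ∃ b ∈ Q, -1 = a + x * b := by
  by_contra h
  exact hx (hQ.max _ (hQ.toIsPre.adjoin x) h
    (fun a ha => ⟨a, ha, 0, hQ.toIsPre.zero, by ring⟩) ⟨0, hQ.toIsPre.zero, 1, hQ.toIsPre.one, by ring⟩)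

lemma IsMaxPre.total {A : Type*} [CommRing A] {Q : Set A} (hQ : IsMaxPre Q) (x : A) :
    x ∈ Q ∨ -x ∈ Q := by
  by_contra! h
  obtain ⟨a, ha, b, hb, h1⟩ := hQ.of_not_mem h.1
  obtain ⟨c, hc, d, hd, h2⟩ := hQ.of_not_mem h.2
  apply hQ.neg_one
  have : (-1 : A) = a + c + a * c + (x * x) * (b * d) := by
    linear_combination (x * d) * h1 + (1 + a) * h2
  rw [this]
  exact hQ.add (hQ.add (hQ.add ha hc) (hQ.mul ha hc)) (hQ.mul (hQ.sq x) (hQ.mul hb hd))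

/-- support ideal -/
def IsMaxPre.supp {A : Type*} [CommRing A] {Q : Set A} (hQ : IsMaxPre Q) : Ideal A where
  carrier := {x | x ∈ Q ∧ -x ∈ Q}
  add_mem' := by
    rintro x y ⟨h1, h2⟩ ⟨h3, h4⟩
    exact ⟨hQ.add h1 h3, by rw [neg_add]; exact hQ.add h2 h4⟩
  zero_mem' := ⟨hQ.toIsPre.zero, by simpa using hQ.toIsPre.zero⟩
  smul_mem' := by
    rintro c x ⟨h1, h2⟩
    rcases hQ.total c with h | h
    · exact ⟨hQ.mul h h1, by simpa using hQ.mul h h2⟩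
    · exact ⟨by simpa using hQ.mul h h2, by simpa using hQ.mul h h1⟩

lemma IsMaxPre.mem_supp {A : Type*} [CommRing A] {Q : Set A} (hQ : IsMaxPre Q) {x : A} :
    x ∈ hQ.supp ↔ x ∈ Q ∧ -x ∈ Q := Iff.rfl

lemma IsMaxPre.prime_aux {A : Type*} [CommRing A] {Q : Set A} (hQ : IsMaxPre Q) {x y : A}
    (hxy : x * y ∈ hQ.supp) (hx : x ∉ Q) (hy : y ∉ Q) : False := by
  obtain ⟨a, ha, b, hb, h1⟩ := hQ.of_not_mem hx
  obtain ⟨c, hc, d, hd, h2⟩ := hQ.of_not_mem hy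
  apply hQ.neg_one
  have : (-1 : A) = a + c + a * c + (-(x * y)) * (b * d) := by
    linear_combination (-y * d) * h1 + (1 + a) * h2
  rw [this]
  exact hQ.add (hQ.add (hQ.add ha hc) (hQ.mul ha hc)) (hQ.mul hxy.2 (hQ.mul hb hd))

lemma IsMaxPre.supp_prime {A : Type*} [CommRing A] {Q : Set A} (hQ : IsMaxPre Q) :
    hQ.supp.IsPrime := by
  refine ⟨?_, ?_⟩
  · intro h
    have : (1 : A) ∈ hQ.supp := by rw [h]; trivial
    exact hQ.neg_one this.2
  · intro x y hxy
    by_contra! h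
    have key : ∀ z, z ∉ hQ.supp → z ∉ Q ∨ -z ∉ Q := by
      intro z hz
      by_contra! h'
      exact hz h'
    have h2 : (-x) * y ∈ hQ.supp := by simpa using hxy
    have h3 : x * (-y) ∈ hQ.supp := by simpa using hxy
    have h4 : (-x) * (-y) ∈ hQ.supp := by simpa using hxy
    rcases key x h.1 with h5 | h5 <;> rcases key y h.2 with h6 | h6
    · exact hQ.prime_aux hxy h5 h6
    · exact hQ.prime_aux h3 h5 h6
    · exact hQ.prime_aux h2 h5 h6
    · exact hQ.prime_aux h4 h5 h6

open Finset MvPolynomial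

/-- polynomial intermediate value property -/
def PIVT (K : Type*) [Field K] [LinearOrder K] : Prop :=
  ∀ (p : Polynomial K) (a b : K), a ≤ b → p.eval a < 0 → 0 < p.eval b →
    ∃ c, a ≤ c ∧ c ≤ b ∧ p.eval c = 0

/-- nonnegative combinations of squares -/
noncomputable def sosK (K : Type*) [Field K] [LinearOrder K] : AddSubmonoid (Polynomial K) :=
  AddSubmonoid.closure {t | ∃ c : K, 0 ≤ c ∧ ∃ f : Polynomial K, t = Polynomial.C c * (f * f)}

section
variable {K : Type*} [Field K] [LinearOrder K] [IsStrictOrderedRing K]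

lemma sosK_eval {s : Polynomial K} (hs : s ∈ sosK K) (x : K) : 0 ≤ s.eval x := by
  induction hs using AddSubmonoid.closure_induction with
  | mem t ht =>
    obtain ⟨c, hc, f, rfl⟩ := ht
    simp only [Polynomial.eval_mul, Polynomial.eval_C]
    exact mul_nonneg hc (mul_self_nonneg _)
  | zero => simp
  | add x y _ _ h1 h2 => simp only [Polynomial.eval_add]; exact add_nonneg h1 h2

lemma sosK_mul {s t : Polynomial K} (hs : s ∈ sosK K) (ht : t ∈ sosK K) : s * t ∈ sosK K := by
  induction hs using AddSubmonoid.closure_induction with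
  | zero => simpa using (sosK K).zero_mem
  | add x y _ _ h1 h2 => rw [add_mul]; exact (sosK K).add_mem h1 h2
  | mem s hs =>
    obtain ⟨c, hc, f, rfl⟩ := hs
    induction ht using AddSubmonoid.closure_induction with
    | zero => simpa using (sosK K).zero_mem
    | add x y _ _ h1 h2 => rw [mul_add]; exact (sosK K).add_mem h1 h2
    | mem t ht =>
      obtain ⟨d, hd, g, rfl⟩ := ht
      exact AddSubmonoid.subset_closure ⟨c * d, mul_nonneg hc hd, f * g, by
        rw [Polynomial.C_mul]; ring⟩

lemma sosK_reduce (p : Polynomial K) (hp : p ≠ 0) {s : Polynomial K} (hs : s ∈ sosK K) :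
    ∃ s' ∈ sosK K, (∃ h, s = s' + p * h) ∧ s'.natDegree ≤ 2 * (p.natDegree - 1) := by
  induction hs using AddSubmonoid.closure_induction with
  | zero => exact ⟨0, (sosK K).zero_mem, ⟨0, by simp⟩, by simp⟩
  | add x y _ _ h1 h2 =>
    obtain ⟨a, ha, ⟨h, rfl⟩, ha2⟩ := h1
    obtain ⟨b, hb, ⟨k, rfl⟩, hb2⟩ := h2
    exact ⟨a + b, (sosK K).add_mem ha hb, ⟨h + k, by ring⟩,
      Polynomial.natDegree_add_le_of_degree_le ha2 hb2⟩
  | mem t ht =>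
    obtain ⟨c, hc, f, rfl⟩ := ht
    refine ⟨Polynomial.C c * ((f % p) * (f % p)), AddSubmonoid.subset_closure ⟨c, hc, _, rfl⟩,
      ⟨Polynomial.C c * ((f / p) * (2 * (f % p) + p * (f / p))), ?_⟩, ?_⟩
    · have := EuclideanDomain.div_add_mod f p
      conv_lhs => rw [← this]
      ring
    · have h1 : (f % p).natDegree ≤ p.natDegree - 1 := by
        by_cases h0 : f % p = 0
        · simp [h0]
        · have := Polynomial.natDegree_lt_natDegree h0 (EuclideanDomain.mod_lt f hp)
          omega
      calc _ ≤ (Polynomial.C c).natDegree + _ := Polynomial.natDegree_mul_le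
        _ ≤ 0 + ((f % p).natDegree + (f % p).natDegree) :=
          add_le_add (by simp) Polynomial.natDegree_mul_le
        _ ≤ _ := by omega

lemma pivt_of_ext (H : ∀ p : Polynomial K, p ≠ 0 →
    (∀ s ∈ sosK K, ∀ h, -1 ≠ s + p * h) → ∃ x, p.eval x = 0) : PIVT K := by
  intro p
  induction hn : p.natDegree using Nat.strong_induction_on generalizing p with
  | _ n ih =>
  intro a b hab ha hb
  by_contra hno
  push Not at hno
  have hp0 : p ≠ 0 := by rintro rfl; simp at ha
  have hdeg : 0 < p.natDegree := by
    by_contra h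
    rw [Polynomial.eq_C_of_natDegree_eq_zero (by omega : p.natDegree = 0)] at ha hb
    simp only [Polynomial.eval_C] at ha hb
    exact absurd (ha.trans hb) (lt_irrefl _)
  by_cases hT : ∀ s ∈ sosK K, ∀ h, -1 ≠ s + p * h
  · obtain ⟨x, hx⟩ := H p hp0 hT
    obtain ⟨q, rfl⟩ := Polynomial.dvd_iff_isRoot.mpr hx
    have hq0 : q ≠ 0 := by rintro rfl; simp at hp0
    have hqd : q.natDegree < n := by
      rw [← hn, Polynomial.natDegree_mul (Polynomial.X_sub_C_ne_zero x) hq0]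
      simp
    simp only [Polynomial.eval_mul, Polynomial.eval_sub, Polynomial.eval_X, Polynomial.eval_C]
      at ha hb hno
    rcases lt_or_ge x a with h1 | h1
    · obtain ⟨c, hc1, hc2, hc⟩ := ih _ hqd q rfl a b hab
        (by by_contra! h; nlinarith [mul_nonneg (sub_pos.2 h1).le h])
        (by by_contra! h; nlinarith [mul_nonneg (sub_pos.2 (h1.trans_le hab)).le (neg_nonneg.2 h)])
      exact hno c hc1 hc2 (by rw [hc]; simp)
    · rcases lt_or_ge b x with h2 | h2
      · obtain ⟨c, hc1, hc2, hc⟩ := ih _ hqd (-q) (by simp) a b hab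
          (by simp only [Polynomial.eval_neg]; by_contra! h
              nlinarith [mul_nonneg (sub_pos.2 (hab.trans_lt h2)).le h])
          (by simp only [Polynomial.eval_neg]; by_contra! h
              nlinarith [mul_nonneg (sub_pos.2 h2).le (neg_nonneg.2 h)])
        simp only [Polynomial.eval_neg, neg_eq_zero] at hc
        exact hno c hc1 hc2 (by rw [hc]; simp)
      · exact hno x h1 h2 (by simp)
  · push Not at hT
    obtain ⟨s, hs, h, hsh⟩ := hT
    obtain ⟨s', hs', ⟨k, rfl⟩, hd⟩ := sosK_reduce p hp0 hs
    have heq : p * (-(h + k)) = 1 + s' := by linear_combination hsh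
    set q := -(h + k) with hq
    have hev : ∀ x, p.eval x * q.eval x = 1 + s'.eval x := by
      intro x; rw [← Polynomial.eval_mul, heq]; simp
    have hpos : ∀ x, 0 < p.eval x * q.eval x := by
      intro x; rw [hev]; linarith [sosK_eval hs' x]
    have hq0 : q ≠ 0 := by
      intro h0; have := hpos 0; rw [h0] at this; simp at this
    have hqd : q.natDegree < n := by
      have h1 := Polynomial.natDegree_mul hp0 hq0
      rw [heq] at h1
      have h2 : (1 + s').natDegree ≤ 2 * (p.natDegree - 1) :=
        Polynomial.natDegree_add_le_of_degree_le (by simp) hd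
      omega
    obtain ⟨c, hc1, hc2, hc⟩ := ih _ hqd q rfl a b hab
      (by by_contra! h; nlinarith [hpos a, mul_nonneg (neg_pos.2 ha).le h])
      (by by_contra! h; nlinarith [hpos b, mul_nonneg hb.le (neg_nonneg.2 h)])
    have := hpos c
    rw [hc] at this; simp at this
end

/-- total ordering cones of subrings of a field -/
structure IsCone {F : Type*} [Field F] (P : Set F) : Prop where
  zero : (0 : F) ∈ P
  one : (1 : F) ∈ P
  add : ∀ {x y}, x ∈ P → y ∈ P → x + y ∈ P
  mul : ∀ {x y}, x ∈ P → y ∈ P → x * y ∈ P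
  anti : ∀ {x}, x ∈ P → -x ∈ P → x = 0
  tot : ∀ {x y}, x ∈ P → y ∈ P → x - y ∈ P ∨ y - x ∈ P

lemma IsCone.exists_max {F : Type*} [Field F] {P0 : Set F} (h0 : IsCone P0) :
    ∃ P, P0 ⊆ P ∧ IsCone P ∧ ∀ P', IsCone P' → P ⊆ P' → P' ⊆ P := by
  obtain ⟨Q, hTQ, hQ⟩ := zorn_subset_nonempty {Q : Set F | IsCone Q} (by
    intro c hc hchain hne
    have two : ∀ {x y}, x ∈ ⋃₀ c → y ∈ ⋃₀ c → ∃ s ∈ c, x ∈ s ∧ y ∈ s := by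
      rintro x y ⟨s, hs, hx⟩ ⟨t, ht, hy⟩
      rcases hchain.total hs ht with h | h
      · exact ⟨t, ht, h hx, hy⟩
      · exact ⟨s, hs, hx, h hy⟩
    obtain ⟨s0, hs0⟩ := hne
    refine ⟨⋃₀ c, ⟨⟨s0, hs0, (hc hs0).zero⟩, ⟨s0, hs0, (hc hs0).one⟩, ?_, ?_, ?_, ?_⟩,
      fun s hs => Set.subset_sUnion_of_mem hs⟩
    · intro x y hx hy
      obtain ⟨s, hs, h1, h2⟩ := two hx hy
      exact ⟨s, hs, (hc hs).add h1 h2⟩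
    · intro x y hx hy
      obtain ⟨s, hs, h1, h2⟩ := two hx hy
      exact ⟨s, hs, (hc hs).mul h1 h2⟩
    · intro x hx hy
      obtain ⟨s, hs, h1, h2⟩ := two hx hy
      exact (hc hs).anti h1 h2
    · intro x y hx hy
      obtain ⟨s, hs, h1, h2⟩ := two hx hy
      exact ((hc hs).tot h1 h2).imp (fun h => ⟨s, hs, h⟩) (fun h => ⟨s, hs, h⟩)) P0 h0
  exact ⟨Q, hTQ, hQ.prop, fun Q' h1 h3 => hQ.le_of_ge h1 h3⟩

lemma IsMaxPre.cone_image {A F : Type*} [CommRing A] [Field F] {Q : Set A} (hQ : IsMaxPre Q)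
    (ψ : A →+* F) (h : ∀ x, x ∈ hQ.supp ↔ ψ x = 0) : IsCone (ψ '' Q) where
  zero := ⟨0, hQ.toIsPre.zero, map_zero _⟩
  one := ⟨1, hQ.toIsPre.one, map_one _⟩
  add := by
    rintro _ _ ⟨x, hx, rfl⟩ ⟨y, hy, rfl⟩
    exact ⟨x + y, hQ.add hx hy, map_add _ _ _⟩
  mul := by
    rintro _ _ ⟨x, hx, rfl⟩ ⟨y, hy, rfl⟩
    exact ⟨x * y, hQ.mul hx hy, map_mul _ _ _⟩
  anti := by
    rintro _ ⟨x, hx, rfl⟩ ⟨y, hy, hxy⟩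
    have h1 : x + y ∈ hQ.supp := (h _).2 (by rw [map_add, hxy]; ring)
    refine (h _).1 ⟨hx, ?_⟩
    have := hQ.add h1.2 hy
    simpa using this
  tot := by
    rintro _ _ ⟨x, hx, rfl⟩ ⟨y, hy, rfl⟩
    rcases hQ.total (x - y) with h | h
    · exact Or.inl ⟨_, h, map_sub _ _ _⟩
    · exact Or.inr ⟨_, h, by rw [neg_sub, map_sub]⟩

open Finset MvPolynomial

section
variable {F : Type*} [Field F] {P : Set F}

lemma IsCone.inv_mem (hP : IsCone P) (hmax : ∀ P', IsCone P' → P ⊆ P' → P' ⊆ P) {x : F}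
    (hx : x ∈ P) : x⁻¹ ∈ P := by
  by_cases hx0 : x = 0
  · simpa [hx0] using hP.zero
  have hc : IsCone {z : F | ∃ c ∈ P, c ≠ 0 ∧ z * c ∈ P} := by
    refine ⟨⟨1, hP.one, one_ne_zero, by simpa using hP.zero⟩,
      ⟨1, hP.one, one_ne_zero, by simpa using hP.one⟩, ?_, ?_, ?_, ?_⟩
    · rintro x y ⟨c, hc, hc0, h1⟩ ⟨d, hd, hd0, h2⟩
      refine ⟨c * d, hP.mul hc hd, mul_ne_zero hc0 hd0, ?_⟩
      have := hP.add (hP.mul h1 hd) (hP.mul h2 hc)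
      convert this using 1; ring
    · rintro x y ⟨c, hc, hc0, h1⟩ ⟨d, hd, hd0, h2⟩
      refine ⟨c * d, hP.mul hc hd, mul_ne_zero hc0 hd0, ?_⟩
      have := (hP.mul h1 h2)
      convert this using 1; ring
    · rintro x ⟨c, hc, hc0, h1⟩ ⟨d, hd, hd0, h2⟩
      have := hP.anti (x := x * c * d) (hP.mul h1 hd) (by
        convert hP.mul h2 hc using 1; ring)
      simpa [hc0, hd0] using this
    · rintro x y ⟨c, hc, hc0, h1⟩ ⟨d, hd, hd0, h2⟩
      rcases hP.tot (hP.mul h1 hd) (hP.mul h2 hc) with h | h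
      · exact Or.inl ⟨c * d, hP.mul hc hd, mul_ne_zero hc0 hd0, by convert h using 1; ring⟩
      · exact Or.inr ⟨c * d, hP.mul hc hd, mul_ne_zero hc0 hd0, by convert h using 1; ring⟩
  exact hmax _ hc (fun z hz => ⟨1, hP.one, one_ne_zero, by simpa using hz⟩)
    ⟨x, hx, hx0, by rw [inv_mul_cancel₀ hx0]; exact hP.one⟩

/-- the ordered subfield of a maximal cone -/
def coneField (hP : IsCone P) (hinv : ∀ x ∈ P, x⁻¹ ∈ P) : Subfield F where
  carrier := {x | x ∈ P ∨ -x ∈ P}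
  zero_mem' := Or.inl hP.zero
  one_mem' := Or.inl hP.one
  add_mem' := by
    rintro x y (hx | hx) (hy | hy)
    · exact Or.inl (hP.add hx hy)
    · have := hP.tot hx hy
      simpa [sub_eq_add_neg, add_comm] using this
    · have := hP.tot hy hx
      simpa [sub_eq_add_neg, add_comm] using this
    · exact Or.inr (by rw [neg_add]; exact hP.add hx hy)
  mul_mem' := by
    rintro x y (hx | hx) (hy | hy)
    · exact Or.inl (hP.mul hx hy)
    · exact Or.inr (by rw [← mul_neg]; exact hP.mul hx hy)
    · exact Or.inr (by rw [← neg_mul]; exact hP.mul hx hy)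
    · exact Or.inl (by rw [← neg_mul_neg]; exact hP.mul hx hy)
  neg_mem' := by
    rintro x (hx | hx)
    · exact Or.inr (by simpa using hx)
    · exact Or.inl hx
  inv_mem' := by
    rintro x (hx | hx)
    · exact Or.inl (hinv _ hx)
    · exact Or.inr (by rw [← inv_neg]; exact hinv _ hx)

/-- the cone itself -/
def coneCone (hP : IsCone P) (hinv : ∀ x ∈ P, x⁻¹ ∈ P) : RingCone (coneField hP hinv) where
  carrier := {x | (x : F) ∈ P}
  zero_mem' := hP.zero
  one_mem' := hP.one
  add_mem' := fun h1 h2 => hP.add h1 h2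
  mul_mem' := fun h1 h2 => hP.mul h1 h2
  eq_zero_of_mem_of_neg_mem' := fun h1 h2 => Subtype.ext (hP.anti h1 h2)

instance (hP : IsCone P) (hinv : ∀ x ∈ P, x⁻¹ ∈ P) : HasMemOrNegMem (coneCone hP hinv) where
  mem_or_neg_mem := fun x => x.2

lemma maxcone_rcf [IsAlgClosed F] (hP : IsCone P)
    (hmax : ∀ P', IsCone P' → P ⊆ P' → P' ⊆ P) :
    ∃ (K : Subfield F) (_ : LinearOrder K) (_ : IsStrictOrderedRing K), PIVT K ∧
      ∀ x (hx : x ∈ P), ∃ h : x ∈ K, (0 : K) ≤ ⟨x, h⟩ := by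
  classical
  have hinv : ∀ x ∈ P, x⁻¹ ∈ P := fun x hx => hP.inv_mem hmax hx
  set K := coneField hP hinv with hK
  let _ : LinearOrder K := LinearOrder.mkOfAddGroupCone (coneCone hP hinv)
  have : IsOrderedRing K := IsOrderedRing.mkOfCone (coneCone hP hinv)
  have : IsStrictOrderedRing K := IsOrderedRing.toIsStrictOrderedRing K
  have nonneg_iff : ∀ x : K, 0 ≤ x ↔ (x : F) ∈ P := by
    intro x
    have : 0 ≤ x ↔ x - 0 ∈ coneCone hP hinv := Iff.rfl
    rw [this, sub_zero]; exact Iff.rfl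
  refine ⟨K, inferInstance, inferInstance, ?_, fun x hx => ⟨Or.inl hx, (nonneg_iff _).2 hx⟩⟩
  apply pivt_of_ext
  intro p hp0 hT
  have hpre : IsPre {t : Polynomial K | ∃ s ∈ sosK K, ∃ h, t = s + p * h} := by
    refine ⟨?_, ?_, ?_⟩
    · rintro _ _ ⟨s, hs, h, rfl⟩ ⟨s', hs', h', rfl⟩
      exact ⟨s + s', (sosK K).add_mem hs hs', h + h', by ring⟩
    · rintro _ _ ⟨s, hs, h, rfl⟩ ⟨s', hs', h', rfl⟩
      exact ⟨s * s', sosK_mul hs hs', s * h' + h * s' + p * h * h', by ring⟩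
    · intro f
      exact ⟨f * f, AddSubmonoid.subset_closure ⟨1, zero_le_one, f, by simp⟩, 0, by simp⟩
  obtain ⟨Q, hTQ, hQ⟩ := hpre.exists_max (by
    rintro ⟨s, hs, h, hh⟩; exact hT s hs h hh)
  have hprime := hQ.supp_prime
  have hpI : p ∈ hQ.supp := ⟨hTQ ⟨0, (sosK K).zero_mem, 1, by simp⟩,
    hTQ ⟨0, (sosK K).zero_mem, -1, by simp⟩⟩
  have hne : hQ.supp ≠ ⊥ := fun h => hp0 (by rw [h] at hpI; simpa using hpI)
  have hmaxI : hQ.supp.IsMaximal := IsPrime.to_maximal_ideal hne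
  obtain ⟨q, hq⟩ := (IsPrincipalIdealRing.principal hQ.supp).principal
  have hq' : hQ.supp = Ideal.span {q} := hq
  have hqdeg : (q.map (algebraMap K F)).degree ≠ 0 := by
    rw [Polynomial.degree_map]
    intro h
    apply hprime.ne_top
    rw [hq', Ideal.span_singleton_eq_top]
    exact Polynomial.isUnit_iff_degree_eq_zero.2 h
  obtain ⟨α, hα⟩ := IsAlgClosed.exists_root _ hqdeg
  let ψ : Polynomial K →+* F := Polynomial.eval₂RingHom (algebraMap K F) α
  have hψq : ψ q = 0 := by
    have : Polynomial.eval α (q.map (algebraMap K F)) = 0 := hα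
    rwa [Polynomial.eval_map] at this
  have hker : hQ.supp = RingHom.ker ψ := by
    apply hmaxI.eq_of_le (RingHom.ker_ne_top ψ)
    rw [hq', Ideal.span_singleton_le_iff_mem]
    exact hψq
  have hcone := hQ.cone_image ψ (fun x => by rw [hker]; exact RingHom.mem_ker)
  have hPsub : P ⊆ ψ '' Q := by
    intro x hx
    have hm : Polynomial.C (⟨x, Or.inl hx⟩ : K) ∈ sosK K := AddSubmonoid.subset_closure
      ⟨⟨x, Or.inl hx⟩, (nonneg_iff _).2 hx, 1, by rw [mul_one, mul_one]⟩
    refine ⟨Polynomial.C ⟨x, Or.inl hx⟩, hTQ ⟨_, hm, 0, by simp⟩, ?_⟩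
    simp [ψ]; rfl
  have hsub := hmax _ hcone hPsub
  have hαK : α ∈ K := by
    have hX : ψ Polynomial.X = α := by simp [ψ]
    rcases hQ.total (Polynomial.X) with h | h
    · exact Or.inl (hsub ⟨_, h, hX⟩)
    · exact Or.inr (hsub ⟨_, h, by rw [map_neg, hX]⟩)
  refine ⟨⟨α, hαK⟩, ?_⟩
  have hψp : ψ p = 0 := by
    have : p ∈ RingHom.ker ψ := hker ▸ hpI
    exact this
  have : algebraMap K F (p.eval ⟨α, hαK⟩) = ψ p := by
    rw [← Polynomial.eval₂_at_apply]; rfl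
  rw [hψp] at this
  simpa using this
end

theorem exists_rcf {A : Type} [CommRing A] {T : Set A} (hT : IsPre T) (h1 : (-1 : A) ∉ T) :
    ∃ (R : Type) (_ : Field R) (_ : LinearOrder R) (_ : IsStrictOrderedRing R), PIVT R ∧
      ∃ φ : A →+* R, ∀ t ∈ T, 0 ≤ φ t := by
  obtain ⟨Q, hTQ, hQ⟩ := hT.exists_max h1
  have := hQ.supp_prime
  let B := A ⧸ hQ.supp
  let F0 := FractionRing B
  let F := AlgebraicClosure F0
  let ψ : A →+* F := ((algebraMap F0 F).comp (algebraMap B F0)).comp (Ideal.Quotient.mk hQ.supp)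
  have hψ : ∀ x, x ∈ hQ.supp ↔ ψ x = 0 := by
    intro x
    rw [← Ideal.Quotient.eq_zero_iff_mem]
    change _ ↔ algebraMap F0 F (algebraMap B F0 _) = 0
    rw [map_eq_zero (algebraMap F0 F), FaithfulSMul.algebraMap_eq_zero_iff]
  obtain ⟨P, hP0, hP, hmax⟩ := (hQ.cone_image ψ hψ).exists_max
  obtain ⟨K, i1, i2, hiv, hK⟩ := maxcone_rcf hP hmax
  have hmem : ∀ x, ψ x ∈ K := by
    intro x
    rcases hQ.total x with h | h
    · exact (hK _ (hP0 ⟨x, h, rfl⟩)).1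
    · have := (hK _ (hP0 ⟨-x, h, rfl⟩)).1
      have h3 := K.neg_mem this
      rwa [map_neg, neg_neg] at h3
  refine ⟨K, inferInstance, i1, i2, hiv, ψ.codRestrict K hmem, ?_⟩
  intro t ht
  exact (hK _ (hP0 ⟨t, hTQ ht, rfl⟩)).2

open Finset MvPolynomial

section
variable {K : Type*} [Field K] [LinearOrder K] [IsStrictOrderedRing K]

lemma PIVT.same_sign (hK : PIVT K) {p : Polynomial K} {a b : K} (hab : a ≤ b)
    (h : ∀ c, a ≤ c → c ≤ b → p.eval c ≠ 0) : 0 < p.eval a ↔ 0 < p.eval b := by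
  constructor
  · intro ha
    by_contra! hb
    obtain ⟨c, h1, h2, h3⟩ := hK (-p) a b hab (by simpa using ha)
      (by simpa using lt_of_le_of_ne hb (h b hab le_rfl))
    exact h c h1 h2 (by simpa using h3)
  · intro hb
    by_contra! ha
    obtain ⟨c, h1, h2, h3⟩ := hK p a b hab (lt_of_le_of_ne ha (h a le_rfl hab)) hb
    exact h c h1 h2 h3

lemma PIVT.const_sign (hK : PIVT K) {p : Polynomial K}
    (h : ∀ c, p.eval c ≠ 0) (a b : K) : 0 < p.eval a ↔ 0 < p.eval b := by
  rcases le_total a b with hab | hab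
  · exact hK.same_sign hab fun c _ _ => h c
  · exact (hK.same_sign hab fun c _ _ => h c).symm

lemma PIVT.rolle_aux (hK : PIVT K) {p : Polynomial K} {a b : K} (hab : a < b)
    (ha : p.eval a = 0) (hb : p.eval b = 0)
    (h : ∀ e, a ≤ e → e ≤ b → p.derivative.eval e ≠ 0) : False := by
  classical
  have hp0 : p ≠ 0 := by rintro rfl; exact h a le_rfl hab.le (by simp)
  obtain ⟨b', hb', hmin⟩ := (p.roots.toFinset.filter (fun x => a < x)).exists_min_image id
    ⟨b, by simp [hp0, hb, hab]⟩
  simp only [Finset.mem_filter, Multiset.mem_toFinset, Polynomial.mem_roots hp0,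
    Polynomial.IsRoot.def, id, and_imp] at hb' hmin
  obtain ⟨hb'0, hab'⟩ := hb'
  have hb'b : b' ≤ b := hmin b hb hab
  obtain ⟨q1, hq1⟩ := Polynomial.dvd_iff_isRoot.mpr ha
  have h1 : q1.eval b' = 0 := by
    have := hb'0
    rw [hq1] at this
    simp only [Polynomial.eval_mul, Polynomial.eval_sub, Polynomial.eval_X, Polynomial.eval_C,
      mul_eq_zero, sub_eq_zero] at this
    exact this.resolve_left hab'.ne'
  obtain ⟨q, hq⟩ := Polynomial.dvd_iff_isRoot.mpr h1
  have hpq : p = (Polynomial.X - Polynomial.C a) * ((Polynomial.X - Polynomial.C b') * q) := by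
    rw [hq1, hq]
  have hda : p.derivative.eval a = (a - b') * q.eval a := by
    rw [hpq]; simp [Polynomial.derivative_mul]
  have hdb : p.derivative.eval b' = (b' - a) * q.eval b' := by
    rw [hpq]; simp [Polynomial.derivative_mul]
  have s1 := hK.same_sign (p := p.derivative) hab'.le (fun e h1 h2 => h e h1 (h2.trans hb'b))
  have s2 := hK.same_sign (p := q) hab'.le (fun e g1 g2 g3 => by
    have hpe : p.eval e = 0 := by rw [hpq]; simp [g3]
    rcases g1.eq_or_lt with rfl | g1
    · exact h a le_rfl hab.le (by rw [hda, g3, mul_zero])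
    · have := g2.antisymm (hmin e hpe g1)
      exact h b' hab'.le hb'b (by rw [hdb, ← this, g3, mul_zero]))
  have hqa : q.eval a ≠ 0 := fun h3 => h a le_rfl hab.le (by rw [hda, h3, mul_zero])
  rw [hda, hdb, mul_pos_iff_of_pos_left (sub_pos.2 hab'), ← s2] at s1
  rcases hqa.lt_or_gt with h4 | h4
  · exact absurd (s1.1 (mul_pos_of_neg_of_neg (sub_neg.2 hab') h4)) h4.not_gt
  · exact absurd (s1.2 h4) (mul_neg_of_neg_of_pos (sub_neg.2 hab') h4).not_gt

lemma PIVT.unique_root (hK : PIVT K) {p : Polynomial K} {c d a b : K}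
    (h : ∀ e, c < e → e < d → p.derivative.eval e ≠ 0)
    (hca : c < a) (had : a < d) (hcb : c < b) (hbd : b < d)
    (ha : p.eval a = 0) (hb : p.eval b = 0) : a = b := by
  rcases lt_trichotomy a b with h1 | h1 | h1
  · exact (hK.rolle_aux h1 ha hb fun e h2 h3 => h e (hca.trans_le h2) (h3.trans_lt hbd)).elim
  · exact h1
  · exact (hK.rolle_aux h1 hb ha fun e h2 h3 => h e (hcb.trans_le h2) (h3.trans_lt had)).elim

lemma PIVT.opp_sign (hK : PIVT K) {p : Polynomial K} {c d a : K}
    (hca : c < a) (had : a < d) (ha : p.eval a = 0) (hda : p.derivative.eval a ≠ 0)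
    (hu : ∀ e, c ≤ e → e ≤ d → p.eval e = 0 → e = a) : 0 < p.eval c ↔ ¬ 0 < p.eval d := by
  obtain ⟨q, hq⟩ := Polynomial.dvd_iff_isRoot.mpr ha
  have hda' : p.derivative.eval a = q.eval a := by
    rw [hq]; simp [Polynomial.derivative_mul]
  have hq0 : ∀ e, c ≤ e → e ≤ d → q.eval e ≠ 0 := by
    intro e h1 h2 h3
    have := hu e h1 h2 (by rw [hq]; simp [h3])
    rw [this, ← hda'] at h3
    exact hda h3
  have s := hK.same_sign (hca.trans had).le hq0
  have hc : p.eval c = (c - a) * q.eval c := by rw [hq]; simp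
  have hd : p.eval d = (d - a) * q.eval d := by rw [hq]; simp
  rw [hc, hd, mul_pos_iff_of_pos_left (sub_pos.2 had), ← s]
  rcases (hq0 c le_rfl (hca.trans had).le).lt_or_gt with h4 | h4
  · exact ⟨fun _ => h4.not_gt, fun _ => mul_pos_of_neg_of_neg (sub_neg.2 hca) h4⟩
  · exact ⟨fun h => absurd h (mul_neg_of_neg_of_pos (sub_neg.2 hca) h4).not_gt,
      fun h => absurd h4 h⟩

lemma root_bound {p : Polynomial K} (hp : p.Monic) {a : K} (ha : p.eval a = 0) :
    |a| ≤ 1 + ∑ i ∈ range p.natDegree, (p.coeff i ^ 2 + 1) := by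
  have hnn : 0 ≤ ∑ i ∈ range p.natDegree, (p.coeff i ^ 2 + 1) :=
    Finset.sum_nonneg fun i _ => by positivity
  rcases le_or_gt |a| 1 with h1 | h1
  · linarith
  obtain ⟨n, hn⟩ : ∃ n, p.natDegree = n + 1 := by
    refine Nat.exists_eq_succ_of_ne_zero fun h0 => ?_
    rw [hp.natDegree_eq_zero.1 h0] at ha
    simp at ha
  rw [Polynomial.eval_eq_sum_range, Finset.sum_range_succ, hp.coeff_natDegree, one_mul] at ha
  have h2 : |a| ^ p.natDegree ≤ (∑ i ∈ range p.natDegree, (p.coeff i ^ 2 + 1)) * |a| ^ n := by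
    rw [← abs_pow, eq_neg_of_add_eq_zero_right ha, abs_neg, Finset.sum_mul]
    refine (Finset.abs_sum_le_sum_abs _ _).trans (Finset.sum_le_sum fun i hi => ?_)
    rw [abs_mul, abs_pow]
    refine mul_le_mul ?_ (pow_le_pow_right₀ h1.le ?_) (by positivity) (by positivity)
    · rw [← sq_abs]; nlinarith [sq_nonneg (|p.coeff i| - 1), abs_nonneg (p.coeff i)]
    · rw [hn] at hi; have := Finset.mem_range.1 hi; omega
  have h3 : |a| ^ p.natDegree = |a| * |a| ^ n := by rw [hn, pow_succ]; ring
  rw [h3] at h2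
  have := le_of_mul_le_mul_right h2 (by positivity)
  linarith
end

open Finset MvPolynomial
set_option linter.unusedSectionVars false

section
variable {R1 R2 : Type*} [Field R1] [LinearOrder R1] [IsStrictOrderedRing R1]
  [Field R2] [LinearOrder R2] [IsStrictOrderedRing R2]

structure MG {G R1 R2 : Type*} [CommRing G] [Field R1] [LinearOrder R1]
    [Field R2] [LinearOrder R2] (u : G →+* R1) (v : G →+* R2) : Prop where
  good : ∀ z, 0 ≤ u z ↔ 0 ≤ v z
  ext : ∀ a b, (∀ f : Polynomial G, 0 ≤ (f.map u).eval a ↔ 0 ≤ (f.map v).eval b) →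
    ∃ z, u z = a ∧ v z = b

section
variable {G : Type*} [CommRing G] {u : G →+* R1} {v : G →+* R2}

lemma MG.symm (h : MG u v) : MG v u :=
  ⟨fun z => (h.good z).symm, fun a b H => by
    obtain ⟨z, h1, h2⟩ := h.ext b a fun f => (H f).symm
    exact ⟨z, h2, h1⟩⟩

lemma MG.eq_zero (h : MG u v) (z : G) : u z = 0 ↔ v z = 0 := by
  have h1 := h.good z
  have h2 := h.good (-z)
  simp only [map_neg, Left.nonneg_neg_iff] at h2
  rw [le_antisymm_iff, le_antisymm_iff, h1, h2]

lemma MG.pos (h : MG u v) (z : G) : 0 < u z ↔ 0 < v z := by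
  rw [lt_iff_le_and_ne, lt_iff_le_and_ne, h.good, ne_comm, Ne, h.eq_zero, ne_comm (a := (0 : R2))]

lemma MG.lt (h : MG u v) (z w : G) : u z < u w ↔ v z < v w := by
  rw [← sub_pos, ← map_sub, h.pos, map_sub, sub_pos]

lemma inv_key {R : Type*} [Field R] [LinearOrder R] [IsStrictOrderedRing R]
    (w : G →+* R) (f : Polynomial G) {z : G} (hw : w z ≠ 0) :
    0 ≤ (f.map w).eval (w z)⁻¹ ↔
        0 ≤ w (z ^ f.natDegree * ∑ i ∈ range (f.natDegree + 1),
          f.coeff i * z ^ (f.natDegree - i)) := by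
  have : w (z ^ f.natDegree * ∑ i ∈ range (f.natDegree + 1),
        f.coeff i * z ^ (f.natDegree - i)) =
      ((w z) ^ f.natDegree) ^ 2 * (f.map w).eval (w z)⁻¹ := by
    rw [Polynomial.eval_map, Polynomial.eval₂_eq_sum_range, sq, mul_assoc, map_mul, map_pow,
      Finset.mul_sum (a := w z ^ f.natDegree), map_sum]
    congr 1
    refine Finset.sum_congr rfl fun i hi => ?_
    have hi : i ≤ f.natDegree := Nat.lt_succ_iff.1 (Finset.mem_range.1 hi)
    obtain ⟨k, hk⟩ := Nat.exists_eq_add_of_le hi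
    rw [hk, map_mul, map_pow, Nat.add_sub_cancel_left, pow_add, inv_pow]
    field_simp
  have hp : 0 < (w z ^ f.natDegree) ^ 2 := sq_pos_of_ne_zero (pow_ne_zero _ hw)
  rw [this, mul_nonneg_iff_of_pos_left hp]

lemma MG.isField (h : MG u v) (z : G) (hz : u z ≠ 0) : ∃ w, u w = (u z)⁻¹ ∧ v w = (v z)⁻¹ := by
  have hz2 : v z ≠ 0 := fun e => hz ((h.eq_zero z).2 e)
  refine h.ext _ _ fun f => ?_
  rw [inv_key u f hz, inv_key v f hz2]
  exact h.good _
end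

section
variable {G : Type*} [Field G] {u : G →+* R1} {v : G →+* R2}

lemma ev_hom {G R : Type*} [CommRing G] [CommRing R] (w : G →+* R) (p : Polynomial G) (z : G) :
    (p.map w).eval (w z) = w (p.eval z) := by
  rw [Polynomial.eval_map, Polynomial.eval₂_at_apply]

def RootProp (u : G →+* R1) (v : G →+* R2) (n : ℕ) : Prop :=
  ∀ p : Polynomial G, p ≠ 0 → p.natDegree < n →
    (∀ a, (p.map u).eval a = 0 → ∃ z, u z = a) ∧ (∀ b, (p.map v).eval b = 0 → ∃ z, v z = b)

lemma RootProp.symm {n : ℕ} (h : RootProp u v n) : RootProp v u n :=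
  fun p h0 hn => (h p h0 hn).symm

lemma MG.signcut (h : MG u v) (h1 : PIVT R1) (h2 : PIVT R2) {n : ℕ} (hn : RootProp u v n)
    {a : R1} {b : R2} (hab : ∀ z, (u z < a ↔ v z < b) ∧ u z ≠ a ∧ v z ≠ b) :
    ∀ (k : ℕ) (f : Polynomial G), f.natDegree ≤ k → f.natDegree < n → f ≠ 0 →
      ((f.map u).eval a ≠ 0 ∧ (f.map v).eval b ≠ 0) ∧
      (0 < (f.map u).eval a ↔ 0 < (f.map v).eval b) := by
  intro k f hk hfn hf0
  have nz : (f.map u).eval a ≠ 0 ∧ (f.map v).eval b ≠ 0 := by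
    constructor
    · intro e
      obtain ⟨z, hz⟩ := (hn f hf0 hfn).1 a e
      exact (hab z).2.1 hz
    · intro e
      obtain ⟨z, hz⟩ := (hn f hf0 hfn).2 b e
      exact (hab z).2.2 hz
  refine ⟨nz, ?_⟩
  clear nz
  induction k generalizing f with
  | zero =>
    rw [Polynomial.eq_C_of_natDegree_le_zero hk]
    simpa using h.pos _
  | succ k ih =>
    by_cases hr : ∃ z, f.eval z = 0
    · obtain ⟨z, hz⟩ := hr
      obtain ⟨q, rfl⟩ := Polynomial.dvd_iff_isRoot.mpr hz
      have hq0 : q ≠ 0 := right_ne_zero_of_mul hf0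
      have hd : ((Polynomial.X - Polynomial.C z) * q).natDegree = q.natDegree + 1 := by
        rw [Polynomial.natDegree_mul (Polynomial.X_sub_C_ne_zero z) hq0,
          Polynomial.natDegree_X_sub_C, add_comm]
      have := ih q (by omega) (by omega) hq0
      simp only [Polynomial.map_mul, Polynomial.map_sub, Polynomial.map_X, Polynomial.map_C,
        Polynomial.eval_mul, Polynomial.eval_sub, Polynomial.eval_X, Polynomial.eval_C]
      obtain ⟨hl, hne1, hne2⟩ := hab z
      have nq1 : (q.map u).eval a ≠ 0 := fun e => by
        obtain ⟨w, hw⟩ := (hn q hq0 (by omega)).1 a e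
        exact (hab w).2.1 hw
      have nq2 : (q.map v).eval b ≠ 0 := fun e => by
        obtain ⟨w, hw⟩ := (hn q hq0 (by omega)).2 b e
        exact (hab w).2.2 hw
      have e1 : 0 < a - u z ↔ 0 < b - v z := by rw [sub_pos, sub_pos, hl]
      have m1 := sub_ne_zero.2 hne1.symm
      have m2 := sub_ne_zero.2 hne2.symm
      rw [mul_pos_iff, mul_pos_iff]
      have t1 : a - u z < 0 ↔ ¬ (0 < a - u z) := by rw [not_lt, le_iff_lt_or_eq]; simp [m1]
      have t2 : b - v z < 0 ↔ ¬ (0 < b - v z) := by rw [not_lt, le_iff_lt_or_eq]; simp [m2]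
      have t3 : (q.map u).eval a < 0 ↔ ¬ (0 < (q.map u).eval a) := by
        rw [not_lt, le_iff_lt_or_eq]; simp [nq1]
      have t4 : (q.map v).eval b < 0 ↔ ¬ (0 < (q.map v).eval b) := by
        rw [not_lt, le_iff_lt_or_eq]; simp [nq2]
      rw [t1, t2, t3, t4, e1, this]
    · have c1 : ∀ c, (f.map u).eval c ≠ 0 := fun c hc => by
        obtain ⟨z, rfl⟩ := (hn f hf0 hfn).1 c hc
        rw [ev_hom, map_eq_zero] at hc
        exact hr ⟨z, hc⟩
      have c2 : ∀ c, (f.map v).eval c ≠ 0 := fun c hc => by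
        obtain ⟨z, rfl⟩ := (hn f hf0 hfn).2 c hc
        rw [ev_hom, map_eq_zero] at hc
        exact hr ⟨z, hc⟩
      rw [h1.const_sign c1 a (u 0), h2.const_sign c2 b (v 0), ev_hom, ev_hom]
      exact h.pos _
end
end

open Finset MvPolynomial
set_option linter.unusedSectionVars false

section
variable {R1 R2 : Type*} [Field R1] [LinearOrder R1] [IsStrictOrderedRing R1]
  [Field R2] [LinearOrder R2] [IsStrictOrderedRing R2]

variable {G : Type*} [Field G] {u : G →+* R1} {v : G →+* R2}

lemma MG.half_monic (h : MG u v) (h1 : PIVT R1) (h2 : PIVT R2) {n : ℕ} (hn : RootProp u v n)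
    (p : Polynomial G) (hp : p.Monic) (hpn : p.natDegree = n) (a : R1)
    (ha : (p.map u).eval a = 0) : ∃ z, u z = a := by
  classical
  by_contra hno
  have hno : ∀ z, u z ≠ a := fun z hz => hno ⟨z, hz⟩
  have hnr : ∀ z, p.eval z ≠ 0 := by
    intro z hz
    obtain ⟨q, rfl⟩ := Polynomial.dvd_iff_isRoot.mpr hz
    have hq0 : q ≠ 0 := right_ne_zero_of_mul hp.ne_zero
    have hd : ((Polynomial.X - Polynomial.C z) * q).natDegree = q.natDegree + 1 := by
      rw [Polynomial.natDegree_mul (Polynomial.X_sub_C_ne_zero z) hq0,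
        Polynomial.natDegree_X_sub_C, add_comm]
    simp only [Polynomial.map_mul, Polynomial.map_sub, Polynomial.map_X, Polynomial.map_C,
        Polynomial.eval_mul, Polynomial.eval_sub, Polynomial.eval_X, Polynomial.eval_C,
        mul_eq_zero, sub_eq_zero] at ha
    obtain ⟨w, hw⟩ := (hn q hq0 (by omega)).1 a (ha.resolve_left (hno z).symm)
    exact hno w hw
  have hp1 : p ≠ 1 := by rintro rfl; simp at ha
  haveI : CharZero G := ⟨fun m k hmk => by
    have := congrArg u hmk
    simpa using this⟩
  have hp'0 : p.derivative ≠ 0 := fun e =>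
    hp1 (hp.natDegree_eq_zero.1 (Polynomial.natDegree_eq_zero_of_derivative_eq_zero e))
  have hn0 : p.natDegree ≠ 0 := fun e => hp1 (hp.natDegree_eq_zero.1 e)
  have hp'n : p.derivative.natDegree < n := hpn ▸ Polynomial.natDegree_derivative_lt hn0
  have hp'a : ((p.map u).derivative).eval a ≠ 0 := by
    rw [Polynomial.derivative_map]
    intro e
    obtain ⟨z, hz⟩ := (hn _ hp'0 hp'n).1 a e
    exact hno z hz
  obtain ⟨B, hB⟩ : ∃ B : G, |a| < u B := by
    refine ⟨2 + ∑ i ∈ range p.natDegree, (p.coeff i ^ 2 + 1), ?_⟩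
    have := root_bound (hp.map u) ha
    rw [Polynomial.natDegree_map] at this
    simp only [Polynomial.coeff_map] at this
    simp only [map_add, map_sum, map_pow, map_one, map_ofNat]
    linarith
  rw [abs_lt] at hB
  obtain ⟨c, hc, hcmax⟩ := ((insert (-B) p.derivative.roots.toFinset).filter
    (fun z => u z < a)).exists_max_image u ⟨-B, by simp [hB.1]⟩
  obtain ⟨d, hd, hdmin⟩ := ((insert B p.derivative.roots.toFinset).filter
    (fun z => a < u z)).exists_min_image u ⟨B, by simp [hB.2]⟩
  have hca := (Finset.mem_filter.1 hc).2
  have had := (Finset.mem_filter.1 hd).2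
  have hI1 : ∀ e, u c < e → e < u d → ((p.map u).derivative).eval e ≠ 0 := by
    intro e e1 e2 e3
    rw [Polynomial.derivative_map] at e3
    obtain ⟨z, rfl⟩ := (hn _ hp'0 hp'n).1 e e3
    rw [ev_hom, map_eq_zero] at e3
    rcases (hno z).lt_or_gt with h4 | h4
    · exact absurd (hcmax z (by simp [hp'0, e3, h4])) e1.not_ge
    · exact absurd (hdmin z (by simp [hp'0, e3, h4])) e2.not_ge
  have hI2 : ∀ e, v c < e → e < v d → ((p.map v).derivative).eval e ≠ 0 := by
    intro e e1 e2 e3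
    rw [Polynomial.derivative_map] at e3
    obtain ⟨z, rfl⟩ := (hn _ hp'0 hp'n).2 e e3
    rw [ev_hom, map_eq_zero] at e3
    refine hI1 (u z) ((h.lt _ _).2 e1) ((h.lt _ _).2 e2) ?_
    rw [Polynomial.derivative_map, ev_hom, e3, map_zero]
  have nr1 : ∀ z, (p.map u).eval (u z) ≠ 0 := fun z => by
    rw [ev_hom]; simpa using hnr z
  have nr2 : ∀ z, (p.map v).eval (v z) ≠ 0 := fun z => by
    rw [ev_hom]; simpa using hnr z
  have U1 : ∀ e, u c ≤ e → e ≤ u d → (p.map u).eval e = 0 → e = a := fun e e1 e2 e3 =>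
    h1.unique_root hI1 (lt_of_le_of_ne e1 (by rintro rfl; exact nr1 _ e3))
      (lt_of_le_of_ne e2 (by rintro rfl; exact nr1 _ e3)) hca had e3 ha
  have hopp := h1.opp_sign hca had ha hp'a U1
  have hsg : ∀ z, 0 < (p.map u).eval (u z) ↔ 0 < (p.map v).eval (v z) := fun z => by
    rw [ev_hom, ev_hom, h.pos]
  have hcd : v c < v d := (h.lt _ _).1 (hca.trans had)
  have hopp2 := hopp
  rw [hsg, hsg] at hopp2
  obtain ⟨b, hcb, hbd, hb⟩ : ∃ b, v c ≤ b ∧ b ≤ v d ∧ (p.map v).eval b = 0 := by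
    by_cases hs : 0 < (p.map v).eval (v c)
    · obtain ⟨b, q1, q2, q3⟩ := h2 (-(p.map v)) _ _ hcd.le (by simpa using hs)
        (by simpa using lt_of_le_of_ne (not_lt.1 (hopp2.1 hs)) (nr2 d))
      exact ⟨b, q1, q2, by simpa using q3⟩
    · exact h2 _ _ _ hcd.le (lt_of_le_of_ne (not_lt.1 hs) (nr2 c))
        (not_not.1 fun h' => hs (hopp2.2 h'))
  have hcb : v c < b := lt_of_le_of_ne hcb (by rintro rfl; exact nr2 _ hb)
  have hbd : b < v d := lt_of_le_of_ne hbd (by rintro rfl; exact nr2 _ hb)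
  have U2 : ∀ e, v c ≤ e → e ≤ v d → (p.map v).eval e = 0 → e = b := fun e e1 e2 e3 =>
    h2.unique_root hI2 (lt_of_le_of_ne e1 (by rintro rfl; exact nr2 _ e3))
      (lt_of_le_of_ne e2 (by rintro rfl; exact nr2 _ e3)) hcb hbd e3 hb
  have hnb : ∀ z, v z ≠ b := fun z hz => nr2 z (hz ▸ hb)
  have hcut : ∀ z, (u z < a ↔ v z < b) ∧ u z ≠ a ∧ v z ≠ b := by
    intro z
    refine ⟨⟨fun hza => ?_, fun hzb => ?_⟩, hno z, hnb z⟩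
    · by_contra hzb
      have hzb : b < v z := lt_of_le_of_ne (not_lt.1 hzb) (hnb z).symm
      have hzd : v z < v d := (h.lt _ _).1 (hza.trans had)
      have hcz : u c < u z := (h.lt _ _).2 (hcb.trans hzb)
      have s1 := h1.same_sign (p := p.map u) hcz.le fun e e1 e2 e3 => by
        have := U1 e e1 (e2.trans (hza.trans had).le) e3
        rw [this] at e2
        exact hza.not_ge e2
      have s2 := h2.same_sign (p := p.map v) hzd.le fun e e1 e2 e3 => by
        have := U2 e ((hcb.trans hzb).le.trans e1) e2 e3
        rw [this] at e1
        exact hzb.not_ge e1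
      rw [hsg, hsg, s2] at s1
      tauto
    · by_contra hza
      have hza : a < u z := lt_of_le_of_ne (not_lt.1 hza) (hno z).symm
      have hcz : v c < v z := (h.lt _ _).1 (hca.trans hza)
      have hzd : u z < u d := (h.lt _ _).2 (hzb.trans hbd)
      have s1 := h1.same_sign (p := p.map u) hzd.le fun e e1 e2 e3 => by
        have := U1 e ((hca.trans hza).le.trans e1) e2 e3
        rw [this] at e1
        exact hza.not_ge e1
      have s2 := h2.same_sign (p := p.map v) hcz.le fun e e1 e2 e3 => by
        have := U2 e e1 (e2.trans (hzb.trans hbd).le) e3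
        rw [this] at e2
        exact hzb.not_ge e2
      rw [hsg, hsg, ← s2] at s1
      tauto
  obtain ⟨z, hz, -⟩ := h.ext a b fun f => by
    have e1 : (f.map u).eval a = ((f %ₘ p).map u).eval a := by
      conv_lhs => rw [← Polynomial.modByMonic_add_div f p]
      simp [ha]
    have e2 : (f.map v).eval b = ((f %ₘ p).map v).eval b := by
      conv_lhs => rw [← Polynomial.modByMonic_add_div f p]
      simp [hb]
    rw [e1, e2]
    by_cases hr : f %ₘ p = 0
    · simp [hr]
    · have hlt : (f %ₘ p).natDegree < n := hpn ▸ Polynomial.natDegree_modByMonic_lt f hp hp1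
      obtain ⟨⟨n1, n2⟩, n3⟩ := h.signcut h1 h2 hn hcut _ (f %ₘ p) le_rfl hlt hr
      rw [le_iff_lt_or_eq, le_iff_lt_or_eq, n3]
      simp [n1.symm, n2.symm]
  exact hno z hz

lemma MG.half (h : MG u v) (h1 : PIVT R1) (h2 : PIVT R2) {n : ℕ} (hn : RootProp u v n)
    (p : Polynomial G) (hp : p ≠ 0) (hpn : p.natDegree = n) (a : R1)
    (ha : (p.map u).eval a = 0) : ∃ z, u z = a := by
  refine h.half_monic h1 h2 hn (p * Polynomial.C p.leadingCoeff⁻¹)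
    (Polynomial.monic_mul_leadingCoeff_inv hp) ?_ a ?_
  · rw [Polynomial.natDegree_mul_leadingCoeff_inv _ hp, hpn]
  · simp [ha]

lemma MG.rootProp (h : MG u v) (h1 : PIVT R1) (h2 : PIVT R2) (n : ℕ) : RootProp u v n := by
  induction n with
  | zero => intro p _ hp; omega
  | succ n ih =>
    intro p hp0 hp
    rcases Nat.lt_succ_iff_lt_or_eq.1 hp with hp | hp
    · exact ih p hp0 hp
    · exact ⟨h.half h1 h2 ih p hp0 hp, h.symm.half h2 h1 ih.symm p hp0 hp⟩
end

section
variable {R1 R2 : Type*} [Field R1] [LinearOrder R1] [IsStrictOrderedRing R1]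
  [Field R2] [LinearOrder R2] [IsStrictOrderedRing R2]

theorem MG.closed {G : Type*} [CommRing G] {u : G →+* R1} {v : G →+* R2}
    (hu : Function.Injective u) (h : MG u v) (h1 : PIVT R1) (h2 : PIVT R2)
    (p : Polynomial G) (hp : p ≠ 0) (a : R1) (ha : (p.map u).eval a = 0) : ∃ z, u z = a := by
  have hF : IsField G := by
    refine ⟨⟨0, 1, fun e => ?_⟩, mul_comm, fun {z} hz => ?_⟩
    · have := congrArg u e; simp at this
    · have hz' : u z ≠ 0 := fun e => hz (hu (by rw [e, map_zero]))
      obtain ⟨w, hw, -⟩ := h.isField z hz'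
      exact ⟨w, hu (by rw [map_mul, hw, mul_inv_cancel₀ hz', map_one])⟩
  letI := hF.toField
  exact (MG.rootProp h h1 h2 (p.natDegree + 1) p hp (Nat.lt_succ_self _)).1 a ha

def IsGood (G : Subring (R1 × R2)) : Prop := ∀ z ∈ G, 0 ≤ z.1 ↔ 0 ≤ z.2

lemma exists_MG (G0 : Subring (R1 × R2)) (h0 : IsGood G0) :
    ∃ G : Subring (R1 × R2), G0 ≤ G ∧ IsGood G ∧
      MG ((RingHom.fst R1 R2).comp G.subtype) ((RingHom.snd R1 R2).comp G.subtype) := by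
  obtain ⟨G, hG0, hmax⟩ := zorn_le_nonempty₀ {G : Subring (R1 × R2) | IsGood G} (by
    intro c hc hch y hy
    refine ⟨sSup c, fun z hz => ?_, fun z hz => le_sSup hz⟩
    obtain ⟨s, hs, hzs⟩ := (Subring.mem_sSup_of_directedOn ⟨y, hy⟩ hch.directedOn).1 hz
    exact hc hs z hzs) G0 h0
  have hg : IsGood G := hmax.prop
  refine ⟨G, hG0, hg, fun z => hg z z.2, fun a b H => ?_⟩
  let φ : Polynomial G →+* R1 × R2 := Polynomial.eval₂RingHom G.subtype (a, b)
  have f1 : ∀ f, (φ f).1 = (f.map ((RingHom.fst R1 R2).comp G.subtype)).eval a := fun f => by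
    rw [Polynomial.eval_map]
    exact Polynomial.hom_eval₂ f G.subtype (RingHom.fst R1 R2) (a, b)
  have f2 : ∀ f, (φ f).2 = (f.map ((RingHom.snd R1 R2).comp G.subtype)).eval b := fun f => by
    rw [Polynomial.eval_map]
    exact Polynomial.hom_eval₂ f G.subtype (RingHom.snd R1 R2) (a, b)
  have hG' : IsGood φ.range := by
    rintro _ ⟨f, rfl⟩
    rw [f1, f2]; exact H f
  have hle : G ≤ φ.range := fun z hz => ⟨Polynomial.C ⟨z, hz⟩, by simp [φ]⟩
  have := hmax.le_of_ge hG' hle (⟨Polynomial.X, by simp [φ]⟩ : (a, b) ∈ φ.range)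
  exact ⟨⟨_, this⟩, rfl, rfl⟩

lemma IsGood.inj {G : Subring (R1 × R2)} (h : IsGood G) :
    Function.Injective ((RingHom.fst R1 R2).comp G.subtype) := by
  rw [injective_iff_map_eq_zero]
  rintro ⟨z, hz⟩ h0
  have h0 : z.1 = 0 := h0
  have a1 := (h z hz).1 h0.ge
  have a2 := (h (-z) (neg_mem hz)).1 (by simp [h0])
  have : z.2 = 0 := le_antisymm (by simpa using a2) a1
  exact Subtype.ext (Prod.ext h0 this)
end

open Finset MvPolynomial
set_option linter.unusedSectionVars false

lemma pivt_germ {I K : Type*} [Field K] [LinearOrder K] [IsStrictOrderedRing K]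
    (U : Ultrafilter I) (hK : PIVT K) : PIVT (Filter.Germ (U : Filter I) K) := by
  intro p a b hab ha hb
  have hsurj : ∀ x : Filter.Germ (U : Filter I) K, ∃ f : I → K, (f : Filter.Germ (U : Filter I) K) = x :=
    fun x => Filter.Germ.inductionOn x fun f => ⟨f, rfl⟩
  choose c hc using fun i => hsurj (p.coeff i)
  obtain ⟨x, rfl⟩ := hsurj a
  obtain ⟨y, rfl⟩ := hsurj b
  let P : I → Polynomial K := fun s =>
    ∑ i ∈ range (p.natDegree + 1), Polynomial.C (c i s) * Polynomial.X ^ i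
  have hev : ∀ z : I → K, p.eval (z : Filter.Germ (U : Filter I) K) =
      ((fun s => (P s).eval (z s) : I → K) : Filter.Germ (U : Filter I) K) := by
    intro z
    have : (fun s => (P s).eval (z s) : I → K) =
        ∑ i ∈ range (p.natDegree + 1), c i * z ^ i := by
      funext s
      simp [P, Polynomial.eval_finsetSum]
    rw [this, ← Filter.Germ.coe_coeRingHom, map_sum, Polynomial.eval_eq_sum_range]
    refine Finset.sum_congr rfl fun i _ => ?_
    rw [map_mul, map_pow, Filter.Germ.coe_coeRingHom, hc]
  rw [hev] at ha hb
  have ha' : ∀ᶠ s in (U : Filter I), (P s).eval (x s) < 0 := Filter.Germ.coe_lt.1 ha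
  have hb' : ∀ᶠ s in (U : Filter I), 0 < (P s).eval (y s) := Filter.Germ.coe_lt.1 hb
  have hab' : ∀ᶠ s in (U : Filter I), x s ≤ y s := Filter.Germ.coe_le.1 hab
  have : ∀ s, ∃ w, x s ≤ y s → (P s).eval (x s) < 0 → 0 < (P s).eval (y s) →
      x s ≤ w ∧ w ≤ y s ∧ (P s).eval w = 0 := by
    intro s
    by_cases h : x s ≤ y s ∧ (P s).eval (x s) < 0 ∧ 0 < (P s).eval (y s)
    · obtain ⟨w, hw⟩ := hK (P s) _ _ h.1 h.2.1 h.2.2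
      exact ⟨w, fun _ _ _ => hw⟩
    · exact ⟨0, fun h1 h2 h3 => (h ⟨h1, h2, h3⟩).elim⟩
  choose w hw using this
  have hall : ∀ᶠ s in (U : Filter I), x s ≤ w s ∧ w s ≤ y s ∧ (P s).eval (w s) = 0 := by
    filter_upwards [ha', hb', hab'] with s h1 h2 h3
    exact hw s h3 h1 h2
  refine ⟨(w : Filter.Germ (U : Filter I) K), Filter.Germ.coe_le.2 (hall.mono fun s h => h.1),
    Filter.Germ.coe_le.2 (hall.mono fun s h => h.2.1), ?_⟩
  rw [hev]
  exact Filter.Germ.coe_eq.2 (hall.mono fun s h => h.2.2)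

lemma pivt_real : PIVT ℝ := by
  intro p a b hab ha hb
  obtain ⟨c, hc, h0⟩ := intermediate_value_Icc hab (p.continuous.continuousOn)
    (show (0 : ℝ) ∈ _ from ⟨ha.le, hb.le⟩)
  exact ⟨c, hc.1, hc.2, h0⟩

section
variable {R : Type*} [Field R] [LinearOrder R] [IsStrictOrderedRing R]

def ClosedIn (K : Subfield R) : Prop :=
  ∀ p : Polynomial K, p ≠ 0 → ∀ a : R, (p.map K.subtype).eval a = 0 → a ∈ K

lemma ClosedIn.pivt (hR : PIVT R) {K : Subfield R} (hK : ClosedIn K) : PIVT K := by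
  intro p a b hab ha hb
  have hp : p ≠ 0 := by rintro rfl; simp at ha
  obtain ⟨c, h1, h2, h3⟩ := hR (p.map K.subtype) (K.subtype a) (K.subtype b) hab
    (by rw [ev_hom]; exact ha) (by rw [ev_hom]; exact hb)
  have hc := hK p hp c h3
  refine ⟨⟨c, hc⟩, h1, h2, ?_⟩
  have : (p.map K.subtype).eval (K.subtype ⟨c, hc⟩) = 0 := h3
  rw [ev_hom] at this
  exact Subtype.ext this

lemma exists_L {R2 : Type*} [Field R2] [LinearOrder R2] [IsStrictOrderedRing R2]
    (h1 : PIVT R) (h2 : PIVT R2) (G0 : Subring (R × R2)) (h0 : IsGood G0) :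
    ∃ G : Subring (R × R2), G0 ≤ G ∧ IsGood G ∧ ∃ L : Subfield R, ClosedIn L ∧
      ∀ x, x ∈ L ↔ ∃ z ∈ G, z.1 = x := by
  obtain ⟨G, hG0, hg, hM⟩ := exists_MG G0 h0
  let L : Subfield R := { G.map (RingHom.fst R R2) with
    inv_mem' := by
      rintro _ ⟨z, hz, rfl⟩
      by_cases hz0 : z.1 = 0
      · exact ⟨0, G.zero_mem, by simp [hz0]⟩
      · obtain ⟨w, hw, -⟩ := hM.isField ⟨z, hz⟩ hz0
        exact ⟨w, w.2, hw⟩ }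
  have hL : ∀ x, x ∈ L ↔ ∃ z ∈ G, z.1 = x := fun x => Iff.rfl
  refine ⟨G, hG0, hg, L, ?_, hL⟩
  intro p hp a ha
  let j : G →+* L := ((RingHom.fst R R2).comp G.subtype).codRestrict L
    fun z => (hL _).2 ⟨z, z.2, rfl⟩
  have hj : Function.Surjective j := by
    rintro ⟨x, hx⟩
    obtain ⟨z, hz, rfl⟩ := (hL _).1 hx
    exact ⟨⟨z, hz⟩, rfl⟩
  obtain ⟨P, rfl⟩ := Polynomial.map_surjective j hj p
  rw [Polynomial.map_map] at ha
  obtain ⟨z, hz⟩ := hM.closed hg.inj h1 h2 P (by rintro rfl; simp at hp) a ha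
  exact (hL _).2 ⟨z, z.2, hz⟩

lemma exists_cut_ultra (K : Subfield R) {t : R} (ht : t ∉ K) : ∃ U : Ultrafilter K,
    ∀ a : K, ∀ᶠ s in (U : Filter K), (a < s ↔ (a : R) < t) ∧ a ≠ s := by
  classical
  let V : K → Set K := fun a => {s | (a < s ↔ (a : R) < t) ∧ a ≠ s}
  obtain ⟨U, hU⟩ := Ultrafilter.exists_ultrafilter_of_finite_inter_nonempty (V '' Set.univ) (by
    intro T hT
    obtain ⟨A, -, rfl⟩ := Finset.subset_set_image_iff.1 hT
    obtain ⟨m, hm1, hm2⟩ := Order.exists_between_finsets (α := K) (A.filter fun a : K => (a : R) < t)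
      (A.filter fun a : K => t < (a : R)) (by
        intro x hx y hy
        exact Subtype.coe_lt_coe.1 ((Finset.mem_filter.1 hx).2.trans (Finset.mem_filter.1 hy).2))
    refine ⟨m, ?_⟩
    simp only [Finset.coe_image, Set.sInter_image]
    refine Set.mem_iInter₂.2 fun a ha => ?_
    have hat : (a : R) ≠ t := fun e => ht (e ▸ a.2)
    rcases hat.lt_or_gt with h | h
    · have := hm1 a (Finset.mem_filter.2 ⟨ha, h⟩)
      exact ⟨iff_of_true this h, this.ne⟩
    · have := hm2 a (Finset.mem_filter.2 ⟨ha, h⟩)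
      exact ⟨iff_of_false this.not_gt h.not_gt, this.ne'⟩)
  exact ⟨U, fun a => hU ⟨a, trivial, rfl⟩⟩

lemma cut_sign (hR : PIVT R) {K : Subfield R} (hK : ClosedIn K) {t : R} (ht : t ∉ K)
    (U : Ultrafilter K)
    (hU : ∀ a : K, ∀ᶠ s in (U : Filter K), (a < s ↔ (a : R) < t) ∧ a ≠ s)
    (f : Polynomial K) :
    ∀ᶠ s in (U : Filter K), 0 ≤ f.eval s ↔ 0 ≤ (f.map K.subtype).eval t := by
  classical
  by_cases hf : f = 0
  · simp [hf]
  have hft : (f.map K.subtype).eval t ≠ 0 := fun e => ht (hK f hf t e)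
  have := (Filter.eventually_all_finset f.roots.toFinset).2 fun a _ => hU a
  refine this.mono fun s hs => ?_
  have hs : ∀ a, f.eval a = 0 → (a < s ↔ (a : R) < t) ∧ a ≠ s := fun a ha =>
    hs a (by simp [hf, ha])
  have hfs : f.eval s ≠ 0 := fun e => (hs s e).2 rfl
  have hfs' : (f.map K.subtype).eval (s : R) ≠ 0 := by
    rw [show (s : R) = K.subtype s from rfl, ev_hom]; simpa using hfs
  have e1 : 0 < (f.map K.subtype).eval (s : R) ↔ 0 < (f.map K.subtype).eval t := by
    have rt : ∀ e, (f.map K.subtype).eval e = 0 → e ≠ t ∧ e ≠ s ∧ (e < s ↔ e < t) := by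
      intro e he
      have heK := hK f hf e he
      have : (f.map K.subtype).eval (K.subtype ⟨e, heK⟩) = 0 := he
      rw [ev_hom, map_eq_zero] at this
      refine ⟨?_, ?_, (hs _ this).1⟩
      · rintro rfl; exact hft he
      · rintro rfl; exact hfs' he
    rcases le_total (s : R) t with hst | hst
    · refine hR.same_sign hst fun e a1 a2 a3 => ?_
      obtain ⟨b1, b2, b3⟩ := rt e a3
      exact absurd (b3.2 (lt_of_le_of_ne a2 b1)) a1.not_gt
    · refine (hR.same_sign hst fun e a1 a2 a3 => ?_).symm
      obtain ⟨b1, b2, b3⟩ := rt e a3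
      exact absurd (b3.1 (lt_of_le_of_ne a2 b2)) a1.not_gt
  have e2 : 0 < f.eval s ↔ 0 < (f.map K.subtype).eval (s : R) := by
    rw [show (s : R) = K.subtype s from rfl, ev_hom]; rfl
  rw [le_iff_lt_or_eq, le_iff_lt_or_eq, e2, e1]
  simp [hfs.symm, hft.symm]
end

open Finset MvPolynomial
set_option linter.unusedSectionVars false

section
variable {R : Type*} [Field R] [LinearOrder R] [IsStrictOrderedRing R]

structure TP (ι : ℝ →+* R) {d : ℕ} (S : Finset (MvPolynomial (Fin d) ℝ)) (K : Subfield R) :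
    Prop where
  closed : ClosedIn K
  base : ∀ r, ι r ∈ K
  sol : ∀ x : Fin d → R, (∀ i, x i ∈ K) → (∀ p ∈ S, 0 ≤ eval₂ ι x p) →
    ∃ y : Fin d → ℝ, ∀ p ∈ S, 0 ≤ eval y p

lemma iota_nonneg (ι : ℝ →+* R) (r : ℝ) : 0 ≤ ι r ↔ 0 ≤ r := by
  have h : ∀ r : ℝ, 0 ≤ r → 0 ≤ ι r := fun r hr => by
    rw [← Real.mul_self_sqrt hr, map_mul]; exact mul_self_nonneg _
  refine ⟨fun h1 => ?_, h r⟩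
  by_contra! hr
  have h2 := h (-r) (by linarith)
  rw [map_neg] at h2
  have : ι r = 0 := by linarith
  rw [map_eq_zero] at this
  exact hr.ne this

lemma TP.exists_base (hR : PIVT R) (ι : ℝ →+* R) {d : ℕ} (S : Finset (MvPolynomial (Fin d) ℝ)) :
    ∃ K, TP ι S K := by
  obtain ⟨G, hG0, hg, L, hL, hLm⟩ := exists_L hR pivt_real (ι.prod (RingHom.id ℝ)).range (by
    rintro _ ⟨r, rfl⟩
    exact iota_nonneg ι r)
  have hr : ∀ r, (ι r, r) ∈ G := fun r => hG0 ⟨r, rfl⟩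
  refine ⟨L, hL, fun r => (hLm _).2 ⟨_, hr r, rfl⟩, fun x hx hS => ?_⟩
  have hx' : ∀ i, ∃ y : ℝ, ι y = x i := by
    intro i
    obtain ⟨z, hz, hzx⟩ := (hLm _).1 (hx i)
    refine ⟨z.2, ?_⟩
    have hsub := sub_mem hz (hr z.2)
    have a1 := hg _ hsub
    have a2 := hg _ (neg_mem hsub)
    simp only [Prod.fst_sub, Prod.snd_sub, Prod.fst_neg, Prod.snd_neg, sub_self, le_refl,
      neg_zero, iff_true] at a1 a2
    rw [← hzx]
    linarith
  choose y hy using hx'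
  refine ⟨y, fun p hp => ?_⟩
  have := hS p hp
  rw [← iota_nonneg ι]
  have e : ι (eval y p) = eval₂ ι x p := by
    rw [show x = ι ∘ y from funext fun i => (hy i).symm, ← eval₂_id, eval₂_comp_left]
    simp
  rwa [e]

lemma TP.step (hR : PIVT R) {ι : ℝ →+* R} {d : ℕ} {S : Finset (MvPolynomial (Fin d) ℝ)}
    {K : Subfield R} (hK : TP ι S K) (t : R) : ∃ L, TP ι S L ∧ K ≤ L ∧ t ∈ L := by
  by_cases ht : t ∈ K
  · exact ⟨K, hK, le_rfl, ht⟩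
  obtain ⟨U, hU⟩ := exists_cut_ultra K ht
  have hpK := hK.closed.pivt hR
  let Ks := Filter.Germ (U : Filter K) K
  have hpKs : PIVT Ks := pivt_germ U hpK
  let Φ : (K → K) →+* Ks := Filter.Germ.coeRingHom (U : Filter K)
  let cst : K →+* (K → K) := Pi.constRingHom K K
  let ψ : Polynomial K →+* R × Ks :=
    (Polynomial.eval₂RingHom K.subtype t).prod (Φ.comp (Polynomial.eval₂RingHom cst id))
  have hΦ : ∀ w : K → K, 0 ≤ Φ w ↔ ∀ᶠ s in (U : Filter K), 0 ≤ w s := fun w =>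
    Filter.Germ.coe_le
  have hgood0 : IsGood ψ.range := by
    rintro _ ⟨f, rfl⟩
    have h1 : (ψ f).1 = (f.map K.subtype).eval t := (Polynomial.eval_map _ _).symm
    have h2 : (ψ f).2 = Φ (Polynomial.eval₂ cst id f) := rfl
    have h3 : ∀ s, (Polynomial.eval₂ cst id f) s = f.eval s := by
      intro s
      have := Polynomial.hom_eval₂ f cst (Pi.evalRingHom (fun _ : K => K) s) id
      exact this
    rw [h1, h2, hΦ]
    simp only [h3]
    have hc := cut_sign hR hK.closed ht U hU f
    rw [Filter.eventually_congr hc]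
    simp
  obtain ⟨G, hG0, hg, L, hL, hLm⟩ := exists_L hR hpKs ψ.range hgood0
  have hKG : ∀ k : K, ((k : R), Φ (cst k)) ∈ G := fun k =>
    hG0 ⟨Polynomial.C k, by simp [ψ]⟩
  have hKL : K ≤ L := fun k hk => (hLm _).2 ⟨_, hKG ⟨k, hk⟩, rfl⟩
  refine ⟨L, ⟨hL, fun r => hKL (hK.base r), fun x hx hS => ?_⟩, hKL,
    (hLm _).2 ⟨_, hG0 ⟨Polynomial.X, rfl⟩, by simp [ψ]⟩⟩
  choose z hz hzx using fun i => (hLm _).1 (hx i)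
  choose w hw using fun i => (Filter.Germ.inductionOn (z i).2 fun f => ⟨f, rfl⟩ :
    ∃ f : K → K, Φ f = (z i).2)
  let ιK : ℝ →+* K := ι.codRestrict K hK.base
  let θ : ℝ →+* G := (((K.subtype).prod (Φ.comp cst)).comp ιK).codRestrict G
    fun r => hKG (ιK r)
  let Z : Fin d → G := fun i => ⟨z i, hz i⟩
  have key : ∀ p ∈ S, ∀ᶠ s in (U : Filter K), 0 ≤ eval₂ ιK (fun i => w i s) p := by
    intro p hp
    have hE := hg (eval₂ θ Z p : G) (eval₂ θ Z p : G).2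
    have e1 : ((eval₂ θ Z p : G) : R × Ks).1 = eval₂ ι x p := by
      have := hom_eval₂ p θ ((RingHom.fst R Ks).comp G.subtype) Z
      refine this.trans ?_
      congr 1
      exact funext hzx
    have e2 : ((eval₂ θ Z p : G) : R × Ks).2 = Φ (eval₂ (cst.comp ιK) w p) := by
      have := hom_eval₂ p θ ((RingHom.snd R Ks).comp G.subtype) Z
      refine this.trans ?_
      rw [hom_eval₂ p (cst.comp ιK) Φ w]
      congr 1
      exact funext fun i => (hw i).symm
    have e3 : ∀ s, (eval₂ (cst.comp ιK) w p) s = eval₂ ιK (fun i => w i s) p := fun s =>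
      hom_eval₂ p (cst.comp ιK) (Pi.evalRingHom (fun _ : K => K) s) w
    rw [e1, e2, hΦ] at hE
    simpa only [e3] using hE.1 (hS p hp)
  obtain ⟨s, hs⟩ := ((Filter.eventually_all_finset S).2 key).exists
  refine hK.sol (fun i => (w i s : R)) (fun i => (w i s).2) fun p hp => ?_
  have := hs p hp
  have e := hom_eval₂ p ιK K.subtype (fun i => w i s)
  have e' : eval₂ ι (fun i => (w i s : R)) p = ((eval₂ ιK (fun i => w i s) p : K) : R) := e.symm
  rw [e']
  exact this

theorem transfer (hR : PIVT R) (ι : ℝ →+* R) {d : ℕ} (S : Finset (MvPolynomial (Fin d) ℝ))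
    (x : Fin d → R) (hx : ∀ p ∈ S, 0 ≤ eval₂ ι x p) :
    ∃ y : Fin d → ℝ, ∀ p ∈ S, 0 ≤ eval y p := by
  classical
  have : ∀ A : Finset (Fin d), ∃ K, TP ι S K ∧ ∀ i ∈ A, x i ∈ K := by
    intro A
    induction A using Finset.induction_on with
    | empty =>
      obtain ⟨K, hK⟩ := TP.exists_base hR ι S
      exact ⟨K, hK, by simp⟩
    | insert i A _ ih =>
      obtain ⟨K, hK, hA⟩ := ih
      obtain ⟨L, hL, hKL, hi⟩ := hK.step hR (x i)
      refine ⟨L, hL, fun j hj => ?_⟩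
      rcases Finset.mem_insert.1 hj with rfl | hj
      · exact hi
      · exact hKL (hA j hj)
  obtain ⟨K, hK, hA⟩ := this Finset.univ
  exact hK.sol x (fun i => hA i (Finset.mem_univ i)) hx
end


section
variable {d : ℕ}

structure IsQM (M : Set (MvPolynomial (Fin d) ℝ)) : Prop where
  add : ∀ {x y}, x ∈ M → y ∈ M → x + y ∈ M
  sqm : ∀ x {m}, m ∈ M → x ^ 2 * m ∈ M
  one : 1 ∈ M

variable {M : Set (MvPolynomial (Fin d) ℝ)}

lemma IsQM.zero (h : IsQM M) : 0 ∈ M := by simpa using h.sqm 0 h.one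
lemma IsQM.sq (h : IsQM M) (x) : x ^ 2 ∈ M := by simpa using h.sqm x h.one
lemma IsQM.smul (h : IsQM M) {r : ℝ} (hr : 0 ≤ r) {m} (hm : m ∈ M) : C r * m ∈ M := by
  have := h.sqm (C (Real.sqrt r)) hm
  rwa [← C_pow, Real.sq_sqrt hr] at this
lemma IsQM.const (h : IsQM M) {r : ℝ} (hr : 0 ≤ r) : C r ∈ M := by
  simpa using h.smul hr h.one
lemma IsQM.sos (h : IsQM M) {s m} (hs : IsSOS s) (hm : m ∈ M) : s * m ∈ M := by
  obtain ⟨k, q, rfl⟩ := hs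
  rw [Finset.sum_mul]
  exact Finset.sum_induction _ (· ∈ M) (fun _ _ => h.add) h.zero fun i _ => h.sqm _ hm
lemma IsQM.sos_mem (h : IsQM M) {s} (hs : IsSOS s) : s ∈ M := by
  simpa using h.sos hs h.one
lemma IsQM.sum (h : IsQM M) {ι : Type*} (s : Finset ι) (f : ι → MvPolynomial (Fin d) ℝ)
    (hf : ∀ i ∈ s, f i ∈ M) : ∑ i ∈ s, f i ∈ M :=
  Finset.sum_induction _ (· ∈ M) (fun _ _ => h.add) h.zero hf

lemma isQM_sos : IsQM {s : MvPolynomial (Fin d) ℝ | IsSOS s} where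
  add := by
    rintro _ _ ⟨k, q, rfl⟩ ⟨l, r, rfl⟩
    exact ⟨k + l, Fin.append q r, by simp [Fin.sum_univ_add]⟩
  sqm := by
    rintro x _ ⟨k, q, rfl⟩
    exact ⟨k, fun j => x * q j, by simp [Finset.mul_sum, mul_pow]⟩
  one := ⟨1, fun _ => 1, by simp⟩

lemma IsSOS.add' {s t : MvPolynomial (Fin d) ℝ} (hs : IsSOS s) (ht : IsSOS t) : IsSOS (s + t) :=
  isQM_sos.add hs ht
lemma IsSOS.mul' {s t : MvPolynomial (Fin d) ℝ} (hs : IsSOS s) (ht : IsSOS t) : IsSOS (s * t) :=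
  isQM_sos.sos hs ht
lemma IsSOS.sq' (s : MvPolynomial (Fin d) ℝ) : IsSOS (s ^ 2) := isQM_sos.sq s
lemma IsSOS.zero' : IsSOS (0 : MvPolynomial (Fin d) ℝ) := isQM_sos.zero

lemma isQM_QM {ι : Type*} [Fintype ι] (a : ι → MvPolynomial (Fin d) ℝ) : IsQM (QM a) where
  add := by
    rintro _ _ ⟨s, σ, h1, h2, rfl⟩ ⟨t, τ, h3, h4, rfl⟩
    refine ⟨s + t, fun i => σ i + τ i, h1.add' h3, fun i => (h2 i).add' (h4 i), ?_⟩
    simp only [add_mul, Finset.sum_add_distrib]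
    ring
  sqm := by
    rintro x _ ⟨s, σ, h1, h2, rfl⟩
    refine ⟨x ^ 2 * s, fun i => x ^ 2 * σ i, isQM_sos.sqm x h1, fun i => isQM_sos.sqm x (h2 i), ?_⟩
    rw [mul_add, Finset.mul_sum]
    simp only [mul_assoc]
  one := ⟨1, fun _ => 0, isQM_sos.one, fun _ => IsSOS.zero', by simp⟩

/-- adjoining one element to a quadratic module -/
def adj (M : Set (MvPolynomial (Fin d) ℝ)) (h : MvPolynomial (Fin d) ℝ) :
    Set (MvPolynomial (Fin d) ℝ) := {z | ∃ m ∈ M, ∃ s, IsSOS s ∧ z = m + s * h}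

lemma IsQM.adj (hM : IsQM M) (h) : IsQM (adj M h) where
  add := by
    rintro _ _ ⟨m, hm, s, hs, rfl⟩ ⟨n, hn, t, ht, rfl⟩
    exact ⟨m + n, hM.add hm hn, s + t, hs.add' ht, by ring⟩
  sqm := by
    rintro x _ ⟨m, hm, s, hs, rfl⟩
    exact ⟨x ^ 2 * m, hM.sqm x hm, x ^ 2 * s, isQM_sos.sqm x hs, by ring⟩
  one := ⟨1, hM.one, 0, IsSOS.zero', by ring⟩

lemma subset_adj (h) : M ⊆ adj M h := fun m hm => ⟨m, hm, 0, IsSOS.zero', by ring⟩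
lemma IsQM.mem_adj (hM : IsQM M) (h) : h ∈ _root_.adj M h :=
  ⟨0, hM.zero, 1, isQM_sos.one, by ring⟩

def Arch (M : Set (MvPolynomial (Fin d) ℝ)) : Prop := ∀ f, ∃ n : ℝ, C n - f ∈ M

lemma IsQM.mono (hM : IsQM M) {f} {n n' : ℝ} (h : n ≤ n') (hf : C n - f ∈ M) : C n' - f ∈ M := by
  have := hM.add hf (hM.const (sub_nonneg.2 h))
  rw [C_sub] at this
  convert this using 1; ring

lemma Arch.gt (hM : IsQM M) (hA : Arch M) (f) (r : ℝ) : ∃ n : ℝ, r < n ∧ C n - f ∈ M := by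
  obtain ⟨n, hn⟩ := hA f
  exact ⟨max n (r + 1), by simp, hM.mono (le_max_left _ _) hn⟩

def Bd (M : Set (MvPolynomial (Fin d) ℝ)) (f : MvPolynomial (Fin d) ℝ) : Prop :=
  ∃ n : ℝ, 0 < n ∧ C n - f ∈ M ∧ C n + f ∈ M

lemma Bd.add (hM : IsQM M) {f g} (hf : Bd M f) (hg : Bd M g) : Bd M (f + g) := by
  obtain ⟨n, hn, h1, h2⟩ := hf
  obtain ⟨m, hm, h3, h4⟩ := hg
  refine ⟨n + m, by positivity, ?_, ?_⟩
  · have := hM.add h1 h3; rw [C_add]; convert this using 1; ring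
  · have := hM.add h2 h4; rw [C_add]; convert this using 1; ring

lemma Bd.neg {f} (hf : Bd M f) : Bd M (-f) := by
  obtain ⟨n, hn, h1, h2⟩ := hf
  exact ⟨n, hn, by rwa [sub_neg_eq_add], by rwa [← sub_eq_add_neg]⟩

lemma Bd.smul (hM : IsQM M) {f} (hf : Bd M f) {r : ℝ} (hr : 0 < r) : Bd M (C r * f) := by
  obtain ⟨n, hn, h1, h2⟩ := hf
  refine ⟨r * n, by positivity, ?_, ?_⟩
  · have := hM.smul hr.le h1; rw [C_mul]; convert this using 1; ring
  · have := hM.smul hr.le h2; rw [C_mul]; convert this using 1; ring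

lemma C_inv_mul {r : ℝ} (hr : r ≠ 0) : (C r⁻¹ * C r : MvPolynomial (Fin d) ℝ) = 1 := by
  rw [← C_mul, inv_mul_cancel₀ hr, C_1]

lemma IsQM.of_smul (hM : IsQM M) {r : ℝ} (hr : 0 < r) {m} (h : C r * m ∈ M) : m ∈ M := by
  have := hM.smul (inv_pos.2 hr).le h
  rwa [← mul_assoc, C_inv_mul hr.ne', one_mul] at this

lemma Bd.sq (hM : IsQM M) {f} (hf : Bd M f) : Bd M (f ^ 2) := by
  obtain ⟨n, hn, h1, h2⟩ := hf
  refine ⟨n ^ 2, by positivity, ?_, hM.add (hM.const (by positivity)) (hM.sq f)⟩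
  have := hM.add (hM.sqm (C n + f) h1) (hM.sqm (C n - f) h2)
  refine hM.of_smul (show 0 < 2 * n by positivity) ?_
  convert this using 1
  simp only [C_mul, C_pow, map_ofNat]; ring

lemma Bd.mul (hM : IsQM M) {f g} (hf : Bd M f) (hg : Bd M g) : Bd M (f * g) := by
  have h := (((hf.add hM hg).sq hM).add hM ((hf.add hM hg.neg).sq hM).neg).smul hM
    (show (0 : ℝ) < 4⁻¹ by norm_num)
  have e : (C (4⁻¹ : ℝ) * 4 : MvPolynomial (Fin d) ℝ) = 1 := by
    have := C_inv_mul (d := d) (show (4 : ℝ) ≠ 0 by norm_num)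
    rwa [show (C (4 : ℝ) : MvPolynomial (Fin d) ℝ) = 4 from map_ofNat C 4] at this
  convert h using 1
  linear_combination (- f * g) * e

lemma arch_of (hM : IsQM M) (N : ℝ) (h : C N - ∑ i : Fin d, X i ^ 2 ∈ M) : Arch M := by
  have hB : ∀ f, Bd M f := by
    intro f
    induction f using MvPolynomial.induction_on with
    | C r =>
      refine ⟨|r| + 1, by positivity, ?_, ?_⟩
      · rw [← C_sub]; exact hM.const (by linarith [le_abs_self r])
      · rw [← C_add]; exact hM.const (by linarith [neg_abs_le r])
    | add p q hp hq => exact hp.add hM hq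
    | mul_X p i hp =>
      refine hp.mul hM ?_
      have h1 : C N - X i ^ 2 ∈ M := by
        have := hM.add h (hM.sum (Finset.univ.erase i) (fun j => X j ^ 2) fun j _ => hM.sq _)
        rw [← Finset.add_sum_erase _ _ (Finset.mem_univ i)] at this
        convert this using 1; ring
      have h1 := hM.mono (le_max_left N 0) h1
      set N' := max N 0 with hN'
      have hN0 : 0 ≤ N' := le_max_right _ _
      refine ⟨(N' + 1) / 2, by positivity, ?_, ?_⟩
      · refine hM.of_smul (show (0 : ℝ) < 2 by norm_num) ?_
        have := hM.add h1 (hM.sq (X i - 1))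
        convert this using 1
        rw [mul_sub, ← C_mul, show 2 * ((N' + 1) / 2) = N' + 1 by ring]
        simp only [C_add, map_ofNat, C_1]; ring
      · refine hM.of_smul (show (0 : ℝ) < 2 by norm_num) ?_
        have := hM.add h1 (hM.sq (X i + 1))
        convert this using 1
        rw [mul_add, ← C_mul, show 2 * ((N' + 1) / 2) = N' + 1 by ring]
        simp only [C_add, map_ofNat, C_1]; ring
  exact fun f => let ⟨n, _, h, _⟩ := hB f; ⟨n, h⟩

lemma isPre_T (g : MvPolynomial (Fin d) ℝ) : IsPre (adj {s | IsSOS s} g) where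
  add := fun hx hy => (isQM_sos.adj g).add hx hy
  mul := by
    rintro _ _ ⟨m, hm, s, hs, rfl⟩ ⟨n, hn, t, ht, rfl⟩
    refine ⟨m * n + g ^ 2 * (s * t), (IsSOS.mul' hm hn).add' (isQM_sos.sqm g (hs.mul' ht)),
      m * t + s * n, (IsSOS.mul' hm ht).add' (hs.mul' hn), by ring⟩
  sq := fun x => by rw [← sq x]; exact (isQM_sos.adj g).sq x

lemma wormann (g : MvPolynomial (Fin d) ℝ) (N : ℝ) (hN : 0 ≤ N)
    (hg : ∀ x : Fin d → ℝ, 0 ≤ eval x g → ∑ i, x i ^ 2 < N) :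
    ∃ c : ℝ, C c - ∑ i : Fin d, X i ^ 2 ∈ adj {s | IsSOS s} g := by
  set T := adj {s : MvPolynomial (Fin d) ℝ | IsSOS s} g with hT
  have hP : IsPre T := isPre_T g
  have hQ : IsQM T := isQM_sos.adj g
  set q : MvPolynomial (Fin d) ℝ := ∑ i : Fin d, X i ^ 2 with hq
  set p : MvPolynomial (Fin d) ℝ := C N - q with hp
  have key : (-1 : MvPolynomial (Fin d) ℝ) ∈ {z | ∃ a ∈ T, ∃ b ∈ T, z = a + (-p) * b} := by
    by_contra h1
    obtain ⟨R, i1, i2, i3, hR, φ, hφ⟩ := exists_rcf (hP.adjoin (-p)) h1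
    classical
    have e : ∀ f, eval₂ (φ.comp C) (fun i => φ (X i)) f = φ f := fun f => by
      have := hom_eval₂ f (C : ℝ →+* MvPolynomial (Fin d) ℝ) φ X
      rw [eval₂_eta] at this
      exact this.symm
    obtain ⟨y, hy⟩ := transfer hR (φ.comp C) {g, -p} (fun i => φ (X i)) (by
      intro f hf
      rw [e]
      apply hφ
      simp only [Finset.mem_insert, Finset.mem_singleton] at hf
      rcases hf with rfl | rfl
      · exact ⟨f, isQM_sos.mem_adj f, 0, hQ.zero, by ring⟩
      · exact ⟨0, hQ.zero, 1, hQ.one, by ring⟩)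
    have h2 := hg y (hy g (by simp))
    have h3 := hy (-p) (by simp)
    simp [hp, hq] at h3
    linarith
  obtain ⟨t, ht, b, hb, hbt⟩ := key
  have hpq : p + q = C N := by rw [hp]; ring
  have hqT : q ∈ T := hQ.sum _ _ fun i _ => hQ.sq _
  have k1 : (1 + t) * p ∈ T := by
    have := hQ.sqm p hb
    convert this using 1
    linear_combination (-p) * hbt
  have k2 : C N - q + t * C N ∈ T := by
    have := hQ.add k1 (hP.mul ht hqT)
    convert this using 1
    rw [← hpq]; ring
  have hMp : Arch (adj {s : MvPolynomial (Fin d) ℝ | IsSOS s} p) :=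
    arch_of (isQM_sos.adj p) N (isQM_sos.mem_adj p)
  obtain ⟨n, s0, hs0, s1, hs1, hn⟩ := hMp t
  have k3 : (1 + t) * (C n - t) ∈ T := by
    have := hQ.add (hQ.sos hs0 (hQ.add hQ.one ht)) (hQ.sos hs1 k1)
    convert this using 1
    rw [hn]; ring
  have k4 : C (n + n ^ 2 / 4) - t ∈ T := by
    have := hQ.add k3 (hQ.sq (t - C (n / 2)))
    convert this using 1
    have e1 : (C (n / 2) : MvPolynomial (Fin d) ℝ) ^ 2 = C (n ^ 2 / 4) := by
      rw [← C_pow]; congr 1; ring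
    have e2 : 2 * (C (n / 2) : MvPolynomial (Fin d) ℝ) = C n := by
      rw [show (2 : MvPolynomial (Fin d) ℝ) = C 2 from rfl, ← C_mul]; congr 1; ring
    rw [C_add]
    linear_combination (-1) * e1 + t * e2
  refine ⟨N * (1 + (n + n ^ 2 / 4)), ?_⟩
  have := hQ.add k2 (hQ.smul hN k4)
  convert this using 1
  rw [C_mul, C_add, C_1]
  ring
end

open Finset MvPolynomial
set_option linter.unusedSectionVars false

section
variable {d : ℕ} {M Q : Set (MvPolynomial (Fin d) ℝ)}

lemma quarter (x m : MvPolynomial (Fin d) ℝ) :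
    x * m = C (4⁻¹ : ℝ) * ((x + 1) ^ 2 * m) - C (4⁻¹ : ℝ) * ((x - 1) ^ 2 * m) := by
  have e : (C (4⁻¹ : ℝ) * 4 : MvPolynomial (Fin d) ℝ) = 1 := by
    have := C_inv_mul (d := d) (show (4 : ℝ) ≠ 0 by norm_num)
    rwa [show (C (4 : ℝ) : MvPolynomial (Fin d) ℝ) = 4 from map_ofNat C 4] at this
  linear_combination (- x * m) * e

lemma IsQM.supp_mul (hQ : IsQM Q) {m} (h1 : m ∈ Q) (h2 : -m ∈ Q) (x) : x * m ∈ Q := by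
  rw [quarter, sub_eq_add_neg, ← mul_neg, ← mul_neg]
  exact hQ.add (hQ.smul (by norm_num) (hQ.sqm _ h1)) (hQ.smul (by norm_num) (hQ.sqm _ h2))

lemma IsQM.not_neg_const (hQ : IsQM Q) (h1 : (-1 : MvPolynomial (Fin d) ℝ) ∉ Q) {r : ℝ}
    (hr : r < 0) : C r ∉ Q := fun h => h1 <| by
  refine hQ.of_smul (neg_pos.2 hr) ?_
  convert h using 1
  rw [C_neg]; ring

lemma IsQM.exists_max (hM : IsQM M) (h1 : (-1 : MvPolynomial (Fin d) ℝ) ∉ M) :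
    ∃ Q, IsQM Q ∧ M ⊆ Q ∧ -1 ∉ Q ∧ ∀ h, h ∈ Q ∨ -h ∈ Q := by
  obtain ⟨Q, hMQ, hmax⟩ := zorn_le_nonempty₀
    {Q : Set (MvPolynomial (Fin d) ℝ) | IsQM Q ∧ -1 ∉ Q} (by
      intro c hc hch y hy
      refine ⟨⋃₀ c, ⟨⟨?_, ?_, ?_⟩, ?_⟩, fun s hs => Set.subset_sUnion_of_mem hs⟩
      · rintro a b ⟨s, hs, ha⟩ ⟨t, ht, hb⟩
        rcases hch.total hs ht with h | h
        · exact ⟨t, ht, (hc ht).1.add (h ha) hb⟩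
        · exact ⟨s, hs, (hc hs).1.add ha (h hb)⟩
      · rintro x m ⟨s, hs, ha⟩
        exact ⟨s, hs, (hc hs).1.sqm x ha⟩
      · exact ⟨y, hy, (hc hy).1.one⟩
      · rintro ⟨s, hs, ha⟩
        exact (hc hs).2 ha) M ⟨hM, h1⟩
  obtain ⟨hQ, hQ1⟩ := hmax.prop
  refine ⟨Q, hQ, hMQ, hQ1, fun h => ?_⟩
  have key : ∀ k, k ∉ Q → ∃ m ∈ Q, ∃ s, IsSOS s ∧ -1 = m + s * k := by
    intro k hk
    by_contra hcon
    exact hk (hmax.le_of_ge (y := _root_.adj Q k) ⟨hQ.adj k, hcon⟩ (subset_adj k) (hQ.mem_adj k))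
  by_contra! hcon
  obtain ⟨q1, hq1, s1, hs1, e1⟩ := key h hcon.1
  obtain ⟨q2, hq2, s2, hs2, e2⟩ := key (-h) hcon.2
  have n1 : -s1 ∈ Q := by
    have := hQ.add (hQ.add (hQ.sos hs2 hq1) (hQ.sos hs1 hq2)) (hQ.sos_mem hs2)
    convert this using 1
    linear_combination s2 * e1 + s1 * e2
  have := hQ.supp_mul (hQ.sos_mem hs1) n1 h
  apply hQ1
  rw [e1, mul_comm]
  exact hQ.add hq1 this

/-- infinitesimal elements -/
def Inf' (Q : Set (MvPolynomial (Fin d) ℝ)) (h : MvPolynomial (Fin d) ℝ) : Prop :=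
  ∀ ε : ℝ, 0 < ε → C ε + h ∈ Q ∧ C ε - h ∈ Q

lemma C_half (ε : ℝ) : (C ε : MvPolynomial (Fin d) ℝ) = C (ε / 2) + C (ε / 2) := by
  rw [← C_add]; congr 1; ring

lemma Inf'.add (hQ : IsQM Q) {x y} (hx : Inf' Q x) (hy : Inf' Q y) : Inf' Q (x + y) := by
  intro ε hε
  obtain ⟨a1, a2⟩ := hx (ε / 2) (by positivity)
  obtain ⟨b1, b2⟩ := hy (ε / 2) (by positivity)
  rw [C_half]
  refine ⟨?_, ?_⟩
  · convert hQ.add a1 b1 using 1; ring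
  · convert hQ.add a2 b2 using 1; ring

lemma Inf'.neg {x} (hx : Inf' Q x) : Inf' Q (-x) := fun ε hε =>
  ⟨by rw [← sub_eq_add_neg]; exact (hx ε hε).2, by rw [sub_neg_eq_add]; exact (hx ε hε).1⟩

lemma Inf'.smul (hQ : IsQM Q) {x} (hx : Inf' Q x) {r : ℝ} (hr : 0 < r) : Inf' Q (C r * x) := by
  intro ε hε
  obtain ⟨a1, a2⟩ := hx (ε / r) (by positivity)
  have e : (C ε : MvPolynomial (Fin d) ℝ) = C r * C (ε / r) := by
    rw [← C_mul]; congr 1; field_simp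
  rw [e, ← mul_add, ← mul_sub]
  exact ⟨hQ.smul hr.le a1, hQ.smul hr.le a2⟩

lemma Inf'.sqm (hQ : IsQM Q) (hA : Arch Q) {h} (hh : Inf' Q h) (y) : Inf' Q (y ^ 2 * h) := by
  obtain ⟨n, hn, hny⟩ := hA.gt hQ (y ^ 2) 0
  intro ε hε
  obtain ⟨a1, a2⟩ := hh (ε / n) (by positivity)
  have e : (C ε : MvPolynomial (Fin d) ℝ) = C (ε / n) * C n := by
    rw [← C_mul]; congr 1; field_simp
  have b := hQ.smul (show 0 ≤ ε / n by positivity) hny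
  rw [e]
  refine ⟨?_, ?_⟩
  · convert hQ.add (hQ.sqm y a1) b using 1; ring
  · convert hQ.add (hQ.sqm y a2) b using 1; ring

lemma Inf'.mul (hQ : IsQM Q) (hA : Arch Q) {h} (hh : Inf' Q h) (x) : Inf' Q (x * h) := by
  rw [quarter, sub_eq_add_neg]
  exact ((hh.sqm hQ hA _).smul hQ (by norm_num)).add hQ
    (((hh.sqm hQ hA _).smul hQ (by norm_num)).neg)

lemma exists_val (hQ : IsQM Q) (hA : Arch Q) (h1 : (-1 : MvPolynomial (Fin d) ℝ) ∉ Q)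
    (htot : ∀ h, h ∈ Q ∨ -h ∈ Q) (h) : ∃ r : ℝ, Inf' Q (h - C r) := by
  obtain ⟨n, hn⟩ := hA h
  obtain ⟨m, hm⟩ := hA (-h)
  let S : Set ℝ := {r | h - C r ∈ Q}
  have hne : S.Nonempty := ⟨-m, by
    change h - C (-m) ∈ Q
    convert hm using 1; rw [C_neg]; ring⟩
  have hbd : BddAbove S := ⟨n, fun r hr => by
    by_contra! hlt
    refine hQ.not_neg_const h1 (sub_neg.2 hlt) ?_
    have := hQ.add hr hn
    convert this using 1; rw [C_sub]; ring⟩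
  refine ⟨sSup S, fun ε hε => ⟨?_, ?_⟩⟩
  · obtain ⟨r, hr, hlt⟩ := exists_lt_of_lt_csSup hne (show sSup S - ε < sSup S by linarith)
    have := hQ.add hr (hQ.const (show 0 ≤ r - (sSup S - ε) by linarith))
    convert this using 1
    simp only [C_sub]; ring
  · have hnot : sSup S + ε ∉ S := fun hmem => by
      have := le_csSup hbd hmem; linarith
    have := (htot (h - C (sSup S + ε))).resolve_left hnot
    convert this using 1
    simp only [C_add]; ring

lemma jacobi_aux (hM : IsQM M) (hA : Arch M) (f : MvPolynomial (Fin d) ℝ)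
    (hf : ∀ x : Fin d → ℝ, (∀ m ∈ M, 0 ≤ eval x m) → 0 < eval x f) : -1 ∈ adj M (-f) := by
  by_contra h1
  obtain ⟨Q, hQ, hMQ, hQ1, htot⟩ := (hM.adj (-f)).exists_max h1
  have hMQ' : M ⊆ Q := (subset_adj _).trans hMQ
  have hAQ : Arch Q := fun h => let ⟨n, hn⟩ := hA h; ⟨n, hMQ' hn⟩
  choose x hx using fun i => exists_val hQ hAQ hQ1 htot (X i)
  have key : ∀ h, Inf' Q (h - C (eval x h)) := by
    intro h
    induction h using MvPolynomial.induction_on with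
    | C r =>
      simp only [eval_C, sub_self]
      intro ε hε
      simpa using hQ.const hε.le
    | add p q hp hq =>
      convert hp.add hQ hq using 1
      simp only [map_add]; ring
    | mul_X p i hp =>
      convert (hp.mul hQ hAQ (X i)).add hQ ((hx i).mul hQ hAQ (C (eval x p))) using 1
      simp only [map_mul, eval_X]; ring
  have pos : ∀ m ∈ Q, 0 ≤ eval x m := by
    intro m hm
    by_contra! hlt
    have := hQ.add hm (key m (-(eval x m) / 2) (by linarith)).2
    refine hQ.not_neg_const hQ1 (show eval x m / 2 < 0 by linarith) ?_
    convert this using 1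
    have : (C (eval x m) : MvPolynomial (Fin d) ℝ) = C (eval x m / 2) + C (eval x m / 2) :=
      C_half _
    rw [this, neg_div, C_neg]; ring
  have hfx := hf x fun m hm => pos m (hMQ' hm)
  have := pos (-f) (hMQ (hM.mem_adj _))
  rw [map_neg] at this
  linarith

theorem jacobi (hM : IsQM M) (hA : Arch M) (f : MvPolynomial (Fin d) ℝ)
    (hf : ∀ x : Fin d → ℝ, (∀ m ∈ M, 0 ≤ eval x m) → 0 < eval x f) : f ∈ M := by
  obtain ⟨q, hq, s, hs, e⟩ := jacobi_aux hM hA f hf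
  have hsf : s * f - 1 ∈ M := by convert hq using 1; linear_combination e
  obtain ⟨n1, hn1, k1⟩ := hA.gt hM (1 + s ^ 2 * f) 0
  obtain ⟨n2, hn2, k2⟩ := hA.gt hM s 0
  obtain ⟨k, hk, k1, k2⟩ : ∃ k : ℝ, 0 < k ∧ C (2 * k) - (1 + s ^ 2 * f) ∈ M ∧ C (2 * k) - s ∈ M :=
    ⟨n1 + n2, by positivity, hM.mono (by linarith) k1, hM.mono (by linarith) k2⟩
  have hs2 : s * (C (2 * k) - s) ∈ M := by
    refine hM.of_smul (show 0 < 2 * k by positivity) ?_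
    have := hM.add (hM.sqm s k2) (hM.sqm (C (2 * k) - s) (hM.sos_mem hs))
    convert this using 1; ring
  have step : ∀ r : ℝ, 0 ≤ r → f + C r ∈ M → f + C (r - 1 / k ^ 2) ∈ M := by
    intro r hr h
    refine hM.of_smul (show 0 < k ^ 2 by positivity) ?_
    have := hM.add (hM.add (hM.add (hM.sqm (C k - s) h)
      (hM.smul (show 0 ≤ 2 * k by positivity) hsf)) (hM.smul hr hs2)) k1
    convert this using 1
    have e1 : (C (k ^ 2) * C (1 / k ^ 2) : MvPolynomial (Fin d) ℝ) = 1 := by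
      rw [← C_mul, ← C_1]; congr 1; field_simp
    rw [C_sub, mul_add, mul_sub, e1]
    simp only [C_mul, C_pow, map_ofNat]
    ring
  obtain ⟨r0, hr0⟩ := hA (-f)
  have hr0 : f + C r0 ∈ M := by convert hr0 using 1; ring
  have mono : ∀ r r' : ℝ, r ≤ r' → f + C r ∈ M → f + C r' ∈ M := by
    intro r r' h1 h2
    have := hM.add h2 (hM.const (sub_nonneg.2 h1))
    convert this using 1
    rw [C_sub]; ring
  have all : ∀ j : ℕ, f + C (max (r0 - j * (1 / k ^ 2)) 0) ∈ M := by
    intro j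
    induction j with
    | zero => exact mono _ _ (by simp) hr0
    | succ j ih =>
      refine mono _ _ ?_ (step _ (le_max_right _ _) ih)
      have : 0 < 1 / k ^ 2 := by positivity
      rw [sub_le_iff_le_add]
      refine max_le ?_ ?_
      · have := le_max_left (r0 - (j + 1 : ℕ) * (1 / k ^ 2)) 0
        push_cast at this ⊢
        linarith
      · have := le_max_right (r0 - (j + 1 : ℕ) * (1 / k ^ 2)) 0
        linarith
  obtain ⟨j, hj⟩ := exists_nat_gt (r0 / (1 / k ^ 2))
  have hj' : r0 - j * (1 / k ^ 2) ≤ 0 := by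
    have := (div_lt_iff₀ (show 0 < 1 / k ^ 2 by positivity)).1 hj
    linarith
  have := all j
  rw [max_eq_right hj'] at this
  simpa using this
end

theorem putinar (d m : ℕ) (a : Fin m → MvPolynomial (Fin d) ℝ)
    (hne : {x : Fin d → ℝ | ∀ j, 0 ≤ eval x (a j)}.Nonempty)
    (hbdd : Bornology.IsBounded {x : Fin d → ℝ | ∀ j, 0 ≤ eval x (a j)})
    (g : MvPolynomial (Fin d) ℝ) (hg : g ∈ QM a)
    (hgbdd : Bornology.IsBounded {x : Fin d → ℝ | 0 ≤ eval x g})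
    (f : MvPolynomial (Fin d) ℝ)
    (hf : ∀ x : Fin d → ℝ, (∀ j, 0 ≤ eval x (a j)) → 0 < eval x f) :
    f ∈ QM a := by
  have hM := isQM_QM a
  obtain ⟨B, hB0, hB⟩ := hgbdd.exists_pos_norm_le
  obtain ⟨c, hc⟩ := wormann g (d * B ^ 2 + 1) (by positivity) (by
    intro x hx
    have hxB := hB x hx
    have : ∑ i, x i ^ 2 ≤ ∑ _i : Fin d, B ^ 2 := Finset.sum_le_sum fun i _ => by
      have h1 := (norm_le_pi_norm x i).trans hxB
      rw [Real.norm_eq_abs] at h1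
      rw [← sq_abs]
      exact pow_le_pow_left₀ (abs_nonneg _) h1 2
    simp at this
    linarith)
  obtain ⟨s, hs, t, ht, e⟩ := hc
  have hA : Arch (QM a) := arch_of hM c (by
    rw [e]; exact hM.add (hM.sos_mem hs) (hM.sos ht hg))
  refine jacobi hM hA f fun x hx => hf x fun j => hx _ ?_
  classical
  refine ⟨0, fun i => if i = j then 1 else 0, IsSOS.zero', fun i => ?_, by simp⟩
  dsimp only
  split_ifs
  · exact isQM_sos.one
  · exact IsSOS.zero'
end
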